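/- arXiv:math/0306267 — 5 statements merged into one kernel-verified Lean document; each statement's English description precedes it below -/
import Mathlib

section
/- Let q be a prime power and let G be a finite group containing a normal subgroup U and an element t of order q−1 such that G = U⟨t⟩ and U ∩ ⟨t⟩ = {1}. Let χ : 𝔽_q → ℂ^× be a nontrivial additive character, let ν be a generator of the multiplicative group 𝔽_q^×, and let γ : U → 𝔽_q be a surjective map such that the function φ : U → ℂ^×, φ(x) = χ(γ(x)), is a group homomorphism and γ(t x t⁻¹) = ν·γ(x) for all x ∈ U. Then the induced character ψ = Ind_U^G(φ) is an irreducible character of G, and its values are given by: ψ(x) = q−1 for x ∈ U with γ(x) = 0, ψ(x) = −1 for x ∈ U with γ(x) ≠ 0, and ψ(g) = 0 for all g ∈ G with g ∉ U. In particular, ψ is rational-valued. -/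
open scoped BigOperators

/-- `χ : G → ℂ` is the character of an irreducible finite-dimensional complex
representation of `G`. -/
def IsIrreducibleCharacter (G : Type*) [Group G] (χ : G → ℂ) : Prop :=
  ∃ (n : ℕ) (ρ : Representation ℂ G (Fin n → ℂ)),
    (∀ g, χ g = LinearMap.trace ℂ (Fin n → ℂ) (ρ g)) ∧ n ≠ 0 ∧
    ∀ W : Submodule ℂ (Fin n → ℂ), (∀ (g : G), ∀ w ∈ W, ρ g w ∈ W) → W = ⊥ ∨ W = ⊤

open scoped Classical in
/-- The class function on `G` induced from the class function `φ` on the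
subgroup `U`, given by the usual induced character formula. -/
noncomputable def inducedChar {G : Type*} [Group G] [Fintype G]
    (U : Subgroup G) (φ : U → ℂ) : G → ℂ := fun g =>
  (Nat.card U : ℂ)⁻¹ * ∑ x : G, if h : x⁻¹ * g * x ∈ U then φ ⟨x⁻¹ * g * x, h⟩ else 0

open scoped Classical in
/-- Extension by zero to `G` of a function on a subgroup. -/
noncomputable def extendByZero {G : Type*} [Group G] (U : Subgroup G) (φ : U → ℂ) (g : G) : ℂ :=
  if h : g ∈ U then φ ⟨g, h⟩ else 0

lemma extendByZero_of_mem {G : Type*} [Group G] {U : Subgroup G} (φ : U → ℂ) {g : G}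
    (h : g ∈ U) : extendByZero U φ g = φ ⟨g, h⟩ := dif_pos h

lemma extendByZero_of_notMem {G : Type*} [Group G] {U : Subgroup G} (φ : U → ℂ) {g : G}
    (h : g ∉ U) : extendByZero U φ g = 0 := dif_neg h

lemma inducedChar_eq {G : Type*} [Group G] [Fintype G] (U : Subgroup G) (φ : U → ℂ) (g : G) :
    inducedChar U φ g = (Nat.card U : ℂ)⁻¹ * ∑ x : G, extendByZero U φ (x⁻¹ * g * x) := rfl

lemma inducedChar_of_notMem {G : Type*} [Group G] [Fintype G] {U : Subgroup G} (hU : U.Normal)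
    (φ : U → ℂ) {g : G} (hg : g ∉ U) : inducedChar U φ g = 0 := by
  rw [inducedChar_eq, Finset.sum_eq_zero, mul_zero]
  intro x _
  refine extendByZero_of_notMem φ fun h => hg ?_
  simpa [mul_assoc] using hU.conj_mem _ h x

/-- A nonzero finite-dimensional representation without proper nonzero invariant subspaces
affords an irreducible character. -/
lemma isIrreducibleCharacter_of_representation {G V : Type*} [Group G] [AddCommGroup V]
    [Module ℂ V] [FiniteDimensional ℂ V] [Nontrivial V] (ρ : Representation ℂ G V) (ψ : G → ℂ)
    (hψ : ∀ g, ψ g = LinearMap.trace ℂ V (ρ g))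
    (hρ : ∀ W : Submodule ℂ V, (∀ (g : G), ∀ w ∈ W, ρ g w ∈ W) → W = ⊥ ∨ W = ⊤) :
    IsIrreducibleCharacter G ψ := by
  let e := (Module.finBasis ℂ V).equivFun
  let ρ' : Representation ℂ G (Fin (Module.finrank ℂ V) → ℂ) :=
    { toFun := fun g => e.conj (ρ g)
      map_one' := by rw [map_one]; exact LinearEquiv.conj_id e
      map_mul' := fun g h => by rw [map_mul]; exact LinearEquiv.conj_comp e _ _ }
  have hρ' : ∀ g v, ρ' g (e v) = e (ρ g v) := fun g v => by
    change e (ρ g (e.symm (e v))) = _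
    rw [e.symm_apply_apply]
  refine ⟨Module.finrank ℂ V, ρ', fun g => ?_, Module.finrank_pos.ne', fun W hW => ?_⟩
  · rw [hψ]
    exact (LinearMap.trace_conj' (ρ g) e).symm
  · have hsurj : Function.Surjective (e : V →ₗ[ℂ] (Fin (Module.finrank ℂ V) → ℂ)) := e.surjective
    rcases hρ (W.comap (e : V →ₗ[ℂ] _)) (fun g w hw => by
      have := hW g _ hw
      change ρ' g (e w) ∈ W at this
      rwa [hρ'] at this) with h | h
    · left
      rw [← Submodule.map_comap_eq_of_surjective hsurj W, h, Submodule.map_bot]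
    · right
      rw [← Submodule.map_comap_eq_of_surjective hsurj W, h, Submodule.map_top,
        LinearMap.range_eq_top.2 hsurj]

/-- The monomial representation attached to a split extension `π : G → A` with section `s` and a
function `f` on `G` that is multiplicative on the kernel of `π`. -/
noncomputable def monomialRep {G A : Type*} [Group G] [Group A] (π : G →* A) (s : A →* G)
    (hs : ∀ a, π (s a) = a) (f : G → ℂ) (f_one : f 1 = 1)
    (f_mul : ∀ g h, π g = 1 → π h = 1 → f (g * h) = f g * f h) :
    Representation ℂ G (A → ℂ) where
  toFun g :=
    { toFun := fun v a => f (s a * g * (s (a * π g))⁻¹) * v (a * π g)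
      map_add' := fun v w => by ext a; simp [mul_add]
      map_smul' := fun c v => by ext a; simp [mul_left_comm] }
  map_one' := by ext; simp [f_one]
  map_mul' g h := by
    refine LinearMap.ext fun v => funext fun a => ?_
    have key : s a * (g * h) * (s (a * (π g * π h)))⁻¹ =
        (s a * g * (s (a * π g))⁻¹) * (s (a * π g) * h * (s (a * π g * π h))⁻¹) := by
      simp only [map_mul]; group
    simp only [LinearMap.coe_mk, AddHom.coe_mk, Module.End.mul_apply, map_mul π g h]
    rw [key, f_mul _ _ (by simp [hs]) (by simp [hs, mul_assoc])]
    simp only [mul_assoc]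

lemma trace_eq_sum_single {A : Type*} [Fintype A] [DecidableEq A]
    (T : (A → ℂ) →ₗ[ℂ] (A → ℂ)) :
    LinearMap.trace ℂ (A → ℂ) T = ∑ a, T (Pi.single a 1) a := by
  rw [LinearMap.trace_eq_matrix_trace ℂ (Pi.basisFun ℂ A)]
  simp [Matrix.trace]

section monomialRep

variable {G A : Type*} [Group G] [Group A] (π : G →* A) (s : A →* G)
  (hs : ∀ a, π (s a) = a) (f : G → ℂ) (f_one : f 1 = 1)
  (f_mul : ∀ g h, π g = 1 → π h = 1 → f (g * h) = f g * f h)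

lemma monomialRep_apply (g : G) (v : A → ℂ) (a : A) :
    monomialRep π s hs f f_one f_mul g v a = f (s a * g * (s (a * π g))⁻¹) * v (a * π g) := rfl

lemma monomialRep_apply_of_ker {g : G} (hg : π g = 1) (v : A → ℂ) (a : A) :
    monomialRep π s hs f f_one f_mul g v a = f (s a * g * (s a)⁻¹) * v a := by
  rw [monomialRep_apply, hg, mul_one]

lemma monomialRep_apply_section (b : A) (v : A → ℂ) (a : A) :
    monomialRep π s hs f f_one f_mul (s b) v a = v (a * b) := by
  rw [monomialRep_apply, hs, map_mul, mul_inv_cancel, f_one, one_mul]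

variable [Fintype A] [DecidableEq A]

lemma trace_monomialRep_of_ker {g : G} (hg : π g = 1) :
    LinearMap.trace ℂ (A → ℂ) (monomialRep π s hs f f_one f_mul g) =
      ∑ a, f (s a * g * (s a)⁻¹) := by
  simp [trace_eq_sum_single, monomialRep_apply_of_ker π s hs f f_one f_mul hg]

lemma trace_monomialRep_of_not_ker {g : G} (hg : π g ≠ 1) :
    LinearMap.trace ℂ (A → ℂ) (monomialRep π s hs f f_one f_mul g) = 0 := by
  rw [trace_eq_sum_single]
  exact Finset.sum_eq_zero fun a _ => by simp [monomialRep_apply, hg]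

/-- An invariant subspace of a monomial representation containing a coordinate vector is
everything. -/
lemma eq_top_of_single_mem (W : Submodule ℂ (A → ℂ))
    (hW : ∀ g, ∀ w ∈ W, monomialRep π s hs f f_one f_mul g w ∈ W) (b : A)
    (hb : (Pi.single b 1 : A → ℂ) ∈ W) : W = ⊤ := by
  have hsingle : ∀ a : A, (Pi.single a 1 : A → ℂ) ∈ W := fun a => by
    convert hW (s (a⁻¹ * b)) _ hb using 1
    ext c
    rw [monomialRep_apply_section]
    by_cases h : c = a
    · subst h; simp
    · have h' : c * (a⁻¹ * b) ≠ b := fun h2 => h <| by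
        rw [← mul_assoc, mul_eq_right, mul_inv_eq_one] at h2
        exact h2
      simp [h, h']
  refine eq_top_iff.2 fun v _ => ?_
  rw [pi_eq_sum_univ' v]
  refine W.sum_mem fun a _ => W.smul_mem _ ?_
  convert hsingle a using 1

end monomialRep

lemma sum_eq_card_mul_sum_of_surjective {G A : Type*} [Group G] [Fintype G] [Group A] [Fintype A]
    (π : G →* A) (hπ : Function.Surjective π) (h : A → ℂ) :
    ∑ x : G, h (π x) = (Nat.card π.ker : ℂ) * ∑ a, h a := by
  classical
  rw [← Finset.sum_fiberwise_of_maps_to (g := π) (t := Finset.univ) (fun _ _ => Finset.mem_univ _),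
    Finset.mul_sum]
  refine Finset.sum_congr rfl fun a _ => ?_
  rw [Finset.sum_congr rfl (g := fun _ => h a) (fun x hx => by rw [(Finset.mem_filter.1 hx).2]),
    Finset.sum_const, nsmul_eq_mul,
    MonoidHom.card_fiber_eq_of_mem_range π (hπ a) (hπ 1)]
  congr 2
  rw [Nat.card_eq_fintype_card, ← Fintype.card_subtype]
  exact Fintype.card_congr (Equiv.refl _)

lemma sum_mulShift_eq_ite {F : Type*} [Field F] [Fintype F] [DecidableEq F] {χ : AddChar F ℂ}
    (hχ : ∃ a : F, χ a ≠ 1) (y : F) :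
    ∑ x : F, χ (x * y) = if y = 0 then (Fintype.card F : ℂ) else 0 := by
  have hne : χ ≠ 1 := fun h => by
    obtain ⟨a, ha⟩ := hχ
    exact ha (by rw [h, AddChar.one_apply])
  rw [AddChar.sum_mulShift y (AddChar.IsPrimitive.of_ne_one hne)]
  split_ifs <;> simp

lemma sum_units_addChar {F : Type*} [Field F] [Fintype F] [DecidableEq F] (χ : AddChar F ℂ)
    (y : F) : ∑ a : Fˣ, χ ((a : F) * y) = (∑ x : F, χ (x * y)) - 1 := by
  rw [← Finset.sum_erase_add _ _ (Finset.mem_univ (0 : F)), zero_mul, AddChar.map_zero_eq_one,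
    add_sub_cancel_right]
  refine Finset.sum_bij' (fun a _ => (a : F))
    (fun x hx => Units.mk0 x (Finset.ne_of_mem_erase hx)) ?_ ?_ ?_ ?_ ?_ <;> simp

/-- A complement of a normal subgroup given by a homomorphic section yields a retraction. -/
lemma exists_retraction {G A : Type*} [Group G] [Group A] (U : Subgroup G) (hU : U.Normal)
    (s : A →* G) (hinj : Function.Injective s) (hsup : U ⊔ s.range = ⊤) (hinf : U ⊓ s.range = ⊥) :
    ∃ π : G →* A, (∀ a, π (s a) = a) ∧ π.ker = U := by
  have hbij : Function.Bijective ((QuotientGroup.mk' U).comp s) := by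
    constructor
    · rw [injective_iff_map_eq_one]
      intro a ha
      have h : s a ∈ U ⊓ s.range := ⟨(QuotientGroup.eq_one_iff _).1 ha, a, rfl⟩
      rw [hinf, Subgroup.mem_bot] at h
      exact hinj (h.trans (map_one s).symm)
    · intro x
      obtain ⟨g, rfl⟩ := QuotientGroup.mk_surjective x
      obtain ⟨u, hu, _, ⟨a, rfl⟩, rfl⟩ :=
        Subgroup.mem_sup_of_normal_left.1 (hsup ▸ Subgroup.mem_top g : g ∈ U ⊔ s.range)
      refine ⟨a, ?_⟩
      change (s a : G ⧸ U) = _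
      rw [QuotientGroup.mk_mul, (QuotientGroup.eq_one_iff u).2 hu, one_mul]
  let e := MulEquiv.ofBijective _ hbij
  refine ⟨e.symm.toMonoidHom.comp (QuotientGroup.mk' U), fun a => e.symm_apply_apply a, ?_⟩
  ext g
  rw [MonoidHom.mem_ker]
  change e.symm (g : G ⧸ U) = 1 ↔ _
  rw [EmbeddingLike.map_eq_one_iff, QuotientGroup.eq_one_iff]

/-- Conjugation by the powers of `t` scales `γ` by the corresponding powers of `ν`. -/
lemma gamma_conj_section {F G : Type*} [Field F] [Finite F] [Group G] (U : Subgroup G)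
    (hU : U.Normal) {t : G} {ν : Fˣ} (hν : ∀ y : Fˣ, y ∈ Subgroup.zpowers ν) {γ : U → F}
    (hconj : ∀ x : U, γ ⟨t * (x : G) * t⁻¹, hU.conj_mem x.1 x.2 t⟩ = (ν : F) * γ x)
    (s : Fˣ →* G) (hsν : s ν = t) (a : Fˣ) (x : U) :
    γ ⟨s a * (x : G) * (s a)⁻¹, hU.conj_mem x.1 x.2 (s a)⟩ = (a : F) * γ x := by
  obtain ⟨n, rfl⟩ := mem_powers_iff_mem_zpowers.2 (hν a)
  induction n with
  | zero => simp
  | succ n ih =>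
    have h := hconj ⟨_, hU.conj_mem x.1 x.2 (s (ν ^ n))⟩
    simp only at ih
    rw [ih] at h
    simp only [pow_succ', Units.val_mul, mul_assoc] at h ⊢
    rw [← h]
    congr 2
    simp [hsν, mul_assoc]

/-- Let `q` be a prime power (realized as the cardinality of the finite field `F`),
`G` a finite group with a normal subgroup `U` and an element `t` of order `q - 1`
with `G = U⟨t⟩`, `U ∩ ⟨t⟩ = 1`.  Let `χ` be a nontrivial additive character of `F`,
`ν` a generator of `Fˣ`, and `γ : U → F` a surjection such that `φ = χ ∘ γ` is a
homomorphism and `γ(t x t⁻¹) = ν · γ(x)`.  Then `ψ = Ind_U^G(φ)` is an irreducible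
character of `G` with the stated values; in particular it is rational-valued. -/
theorem induced_gelfand_graev_irreducible_and_values
    {F : Type*} [Field F] [Fintype F]
    {G : Type*} [Group G] [Fintype G]
    (U : Subgroup G) (hU : U.Normal) (t : G)
    (ht : orderOf t = Fintype.card F - 1)
    (hUt : U ⊔ Subgroup.zpowers t = ⊤)
    (hUt' : U ⊓ Subgroup.zpowers t = ⊥)
    (χ : AddChar F ℂ) (hχ : ∃ a : F, χ a ≠ 1)
    (ν : Fˣ) (hν : ∀ y : Fˣ, y ∈ Subgroup.zpowers ν)
    (γ : U → F) (hγ : Function.Surjective γ)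
    (hhom : ∀ x y : U, χ (γ (x * y)) = χ (γ x) * χ (γ y))
    (hconj : ∀ x : U, γ ⟨t * (x : G) * t⁻¹, hU.conj_mem x.1 x.2 t⟩ = (ν : F) * γ x) :
    IsIrreducibleCharacter G (inducedChar U fun x => χ (γ x)) ∧
      (∀ x : U, γ x = 0 →
        inducedChar U (fun x => χ (γ x)) (x : G) = (Fintype.card F : ℂ) - 1) ∧
      (∀ x : U, γ x ≠ 0 → inducedChar U (fun x => χ (γ x)) (x : G) = -1) ∧
      (∀ g : G, g ∉ U → inducedChar U (fun x => χ (γ x)) g = 0) ∧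
      (∀ g : G, ∃ r : ℚ, inducedChar U (fun x => χ (γ x)) g = (r : ℂ)) := by
  classical
  have horder : orderOf ν = Fintype.card F - 1 := by
    rw [orderOf_eq_card_of_forall_mem_zpowers hν, Nat.card_eq_fintype_card, Fintype.card_units]
  let s : Fˣ →* G := monoidHomOfForallMemZpowers hν (g' := t) (by rw [ht, horder])
  have hsν : s ν = t := monoidHomOfForallMemZpowers_apply_gen hν _
  have hrange : s.range = Subgroup.zpowers t := by
    rw [MonoidHom.range_eq_map, ← (Subgroup.eq_top_iff' _).2 hν, MonoidHom.map_zpowers, hsν]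
  have hinj : Function.Injective s := by
    rw [injective_iff_map_eq_one]
    intro a ha
    obtain ⟨n, rfl⟩ := mem_powers_iff_mem_zpowers.2 (hν a)
    simp only [map_pow, hsν] at ha
    exact orderOf_dvd_iff_pow_eq_one.1 (horder ▸ ht ▸ orderOf_dvd_of_pow_eq_one ha)
  obtain ⟨π, hs, hker⟩ := exists_retraction U hU s hinj (hrange ▸ hUt) (hrange ▸ hUt')
  have hmem : ∀ g, π g = 1 ↔ g ∈ U := fun g => by rw [← hker, MonoidHom.mem_ker]
  set φ : U → ℂ := fun x => χ (γ x)
  let f := extendByZero U φ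
  have f_mul : ∀ g h, π g = 1 → π h = 1 → f (g * h) = f g * f h := fun g h hg hh => by
    rw [hmem] at hg hh
    simp only [f, extendByZero_of_mem φ hg, extendByZero_of_mem φ hh,
      extendByZero_of_mem φ (U.mul_mem hg hh)]
    exact hhom ⟨g, hg⟩ ⟨h, hh⟩
  have f_one : f 1 = 1 := by
    have h1 := f_mul 1 1 (map_one π) (map_one π)
    have h0 : f 1 ≠ 0 := by
      simp only [f, extendByZero_of_mem φ U.one_mem]
      exact (χ.val_isUnit _).ne_zero
    rw [mul_one] at h1
    exact mul_left_cancel₀ h0 (h1.symm.trans (mul_one _).symm)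
  have f_conj : ∀ (a : Fˣ) (x : U), f (s a * x * (s a)⁻¹) = χ (a * γ x) := fun a x => by
    rw [← gamma_conj_section U hU hν hconj s hsν]
    exact extendByZero_of_mem φ (hU.conj_mem x.1 x.2 (s a))
  have f_inner : ∀ u v : G, u ∈ U → v ∈ U → f (v⁻¹ * u * v) = f u := fun u v hu hv => by
    rw [← hmem] at hu hv
    have hv' : π v⁻¹ = 1 := by rw [map_inv, hv, inv_one]
    rw [f_mul _ _ (by rw [map_mul, hv', hu, one_mul]) hv, f_mul _ _ hv' hu, mul_right_comm,
      ← f_mul _ _ hv' hv, inv_mul_cancel, f_one, one_mul]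
  have hval : ∀ x : U, inducedChar U φ x = ∑ a : Fˣ, χ (a * γ x) := fun x => by
    have hterm : ∀ y : G, f (y⁻¹ * x * y) = χ (((π y)⁻¹ : Fˣ) * γ x) := fun y => by
      have hv : s (π y)⁻¹ * y ∈ U := by rw [← hmem, map_mul, hs, inv_mul_cancel]
      rw [← f_conj, ← f_inner _ _ (hU.conj_mem x.1 x.2 _) hv]
      congr 1
      group
    rw [inducedChar_eq, Finset.sum_congr rfl fun y _ => hterm y,
      sum_eq_card_mul_sum_of_surjective π (fun a => ⟨s a, hs a⟩)
        (fun a => χ ((a⁻¹ : Fˣ) * γ x)), hker, inv_mul_cancel_left₀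
        (Nat.cast_ne_zero.2 Nat.card_pos.ne')]
    exact Equiv.sum_comp (Equiv.inv Fˣ) fun a : Fˣ => χ (a * γ x)
  have hzero : ∀ x : U, γ x = 0 → inducedChar U φ (x : G) = (Fintype.card F : ℂ) - 1 :=
    fun x hx => by rw [hval, sum_units_addChar, sum_mulShift_eq_ite hχ, if_pos hx]
  have hnonzero : ∀ x : U, γ x ≠ 0 → inducedChar U φ (x : G) = -1 :=
    fun x hx => by rw [hval, sum_units_addChar, sum_mulShift_eq_ite hχ, if_neg hx, zero_sub]
  have hout : ∀ g : G, g ∉ U → inducedChar U φ g = 0 := fun g hg => inducedChar_of_notMem hU φ hg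
  refine ⟨?_, hzero, hnonzero, hout, fun g => ?_⟩
  · refine isIrreducibleCharacter_of_representation (monomialRep π s hs f f_one f_mul) _
      (fun g => ?_) fun W hW => ?_
    · by_cases hg : g ∈ U
      · rw [trace_monomialRep_of_ker π s hs f f_one f_mul ((hmem g).2 hg), hval ⟨g, hg⟩]
        exact Finset.sum_congr rfl fun a _ => (f_conj a ⟨g, hg⟩).symm
      · rw [trace_monomialRep_of_not_ker π s hs f f_one f_mul (mt (hmem g).1 hg), hout g hg]
    · refine or_iff_not_imp_left.2 fun hbot => ?_
      obtain ⟨v, hv, hv0⟩ := W.ne_bot_iff.1 hbot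
      obtain ⟨b, hb⟩ := Function.ne_iff.1 hv0
      choose u hu using hγ
      refine eq_top_of_single_mem π s hs f f_one f_mul W hW b ?_
      have hsum : (∑ x : F, χ (-(x * b)) • monomialRep π s hs f f_one f_mul (u x) v) ∈ W :=
        W.sum_mem fun x _ => W.smul_mem _ (hW _ _ hv)
      have hproj : (∑ x : F, χ (-(x * b)) • monomialRep π s hs f f_one f_mul (u x) v) =
          ((Fintype.card F : ℂ) * v b) • (Pi.single b 1 : Fˣ → ℂ) := by
        ext a
        have hcoord : ∀ x : F,
            χ (-(x * b)) * monomialRep π s hs f f_one f_mul (u x) v a =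
              χ (x * (a - b)) * v a := fun x => by
          rw [monomialRep_apply_of_ker π s hs f f_one f_mul ((hmem _).2 (u x).2), f_conj, hu,
            ← mul_assoc, ← AddChar.map_add_eq_mul]
          ring_nf
        simp only [Finset.sum_apply, Pi.smul_apply, smul_eq_mul, hcoord]
        rw [← Finset.sum_mul, sum_mulShift_eq_ite hχ]
        by_cases hab : a = b
        · simp [hab]
        · have hab' : (a : F) ≠ b := fun h => hab (Units.ext h)
          simp [hab, sub_eq_zero, hab']
      rw [hproj] at hsum
      exact (W.smul_mem_iff (mul_ne_zero (Nat.cast_ne_zero.2 Fintype.card_ne_zero) hb)).1 hsum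
  · by_cases hg : g ∈ U
    · by_cases hx : γ ⟨g, hg⟩ = 0
      · exact ⟨Fintype.card F - 1, by rw [hzero ⟨g, hg⟩ hx]; push_cast; rfl⟩
      · exact ⟨-1, by rw [hnonzero ⟨g, hg⟩ hx]; push_cast; rfl⟩
    · exact ⟨0, by rw [hout g hg, Rat.cast_zero]⟩
end

section
/- Let q be a prime power and let G be a finite group containing a normal subgroup U and an element t of order q−1 such that G = U⟨t⟩ and U ∩ ⟨t⟩ = {1}. Let χ : 𝔽_q → ℂ^× be a nontrivial additive character, let ν be a generator of the multiplicative group 𝔽_q^×, and let γ : U → 𝔽_q be a surjective map such that the function φ : U → ℂ^×, φ(x) = χ(γ(x)), is a group homomorphism and γ(t x t⁻¹) = ν·γ(x) for all x ∈ U. Then the induced character ψ = Ind_U^G(φ) is realizable over ℚ. -/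
open scoped BigOperators

/-- A class function `χ : G → ℂ` is realizable over `ℚ` if it is the character of a
finite-dimensional representation of `G` defined over `ℚ` (equivalently, of a
matrix representation with rational entries, whose complexification then has
character `χ`). -/
def RealizableOverRat {G : Type*} [Group G] (χ : G → ℂ) : Prop :=
  ∃ (n : ℕ) (ρ : G →* Matrix (Fin n) (Fin n) ℚ), ∀ g, χ g = ((ρ g).trace : ℂ)


/-- In the permutation module of a pointed finite set `(X, o)`, the differences `e_a - e_o` with
`a ≠ o` are a basis of the augmentation submodule; this is the matrix of a permutation in that
basis. -/
def augmentationMatrix {X : Type*} [DecidableEq X] (o : X) (σ : Equiv.Perm X) :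
    Matrix {a : X // a ≠ o} {a : X // a ≠ o} ℚ :=
  fun b a => (if b.1 = σ a.1 then 1 else 0) - (if b.1 = σ o then 1 else 0)

theorem sum_subtype_ne_eq {X : Type*} [Fintype X] [DecidableEq X] (o : X) (f : X → ℚ)
    (hf : f o = 0) : ∑ b : {a : X // a ≠ o}, f b = ∑ b, f b := by
  rw [Fintype.sum_eq_add_sum_subtype_ne f o, hf, zero_add]

theorem augmentationMatrix_one {X : Type*} [DecidableEq X] (o : X) :
    augmentationMatrix o 1 = 1 := by
  ext b a
  simp only [augmentationMatrix, Matrix.one_apply, Equiv.Perm.one_apply, b.2, Subtype.ext_iff,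
    if_false, sub_zero]
  congr

theorem augmentationMatrix_mul {X : Type*} [Fintype X] [DecidableEq X] (o : X)
    (σ τ : Equiv.Perm X) :
    augmentationMatrix o (σ * τ) = augmentationMatrix o σ * augmentationMatrix o τ := by
  ext c a
  rw [Matrix.mul_apply]
  simp only [augmentationMatrix]
  rw [sum_subtype_ne_eq o (fun b => ((if c.1 = σ b then (1 : ℚ) else 0) -
    (if c.1 = σ o then 1 else 0)) * ((if b = τ a then 1 else 0) - (if b = τ o then 1 else 0)))
    (by simp)]
  simp only [mul_sub, Finset.sum_sub_distrib, mul_ite, mul_one, mul_zero, Finset.sum_ite_eq',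
    Finset.mem_univ, if_true, Equiv.Perm.mul_apply]
  rw [sub_sub_sub_cancel_right]
  congr

theorem trace_augmentationMatrix {X : Type*} [Fintype X] [DecidableEq X] (o : X)
    (σ : Equiv.Perm X) :
    (augmentationMatrix o σ).trace = (∑ a, if σ a = a then (1 : ℚ) else 0) - 1 := by
  simp only [Matrix.trace, Matrix.diag_apply, augmentationMatrix]
  have h := Fintype.sum_eq_add_sum_subtype_ne
    (fun a => (if a = σ a then (1 : ℚ) else 0) - (if a = σ o then 1 else 0)) o
  simp only [sub_self, zero_add] at h
  rw [← h]
  simp [Finset.sum_sub_distrib, eq_comm]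

/-- A character which is one less than a permutation character is realizable over `ℚ`. -/
theorem realizableOverRat_of_fixedPoints_sub_one {G : Type*} [Group G] {X : Type*} [Fintype X]
    [DecidableEq X] (o : X) (α : G →* Equiv.Perm X) (χ : G → ℂ)
    (hχ : ∀ g, χ g = (∑ a, if α g a = a then (1 : ℂ) else 0) - 1) : RealizableOverRat χ := by
  let e := Fintype.equivFin {a : X // a ≠ o}
  let A : G →* Matrix {a : X // a ≠ o} {a : X // a ≠ o} ℚ :=
    { toFun := fun g => augmentationMatrix o (α g)
      map_one' := by rw [map_one, augmentationMatrix_one]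
      map_mul' := fun g h => by rw [map_mul, augmentationMatrix_mul] }
  refine ⟨_, (Matrix.reindexAlgEquiv ℚ ℚ e).toMulEquiv.toMonoidHom.comp A, fun g => ?_⟩
  have : (Matrix.reindexAlgEquiv ℚ ℚ e (A g)).trace = (A g).trace := by
    simp only [Matrix.coe_reindexAlgEquiv, Matrix.trace, Matrix.diag_apply,
      Matrix.reindex_apply, Matrix.submatrix_apply]
    exact e.symm.sum_comp fun i => A g i i
  have h2 : (A g).trace = (∑ a, if α g a = a then (1 : ℚ) else 0) - 1 :=
    trace_augmentationMatrix o (α g)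
  change _ = (((Matrix.reindexAlgEquiv ℚ ℚ e (A g)).trace : ℚ) : ℂ)
  rw [this, h2, hχ g]
  push_cast [apply_ite]
  rfl

theorem inducedChar_eq_zero_of_notMem {G : Type*} [Group G] [Fintype G] (U : Subgroup G)
    (hU : U.Normal) (φ : U → ℂ) {g : G} (hg : g ∉ U) : inducedChar U φ g = 0 := by
  have h (x : G) : x⁻¹ * g * x ∉ U := fun hx => hg (by
    simpa [mul_assoc] using hU.conj_mem _ hx x)
  simp [inducedChar, h]

/-- Restriction of an induced character to a normal complemented subgroup. -/
theorem inducedChar_apply_of_isComplement {G : Type*} [Group G] [Fintype G] {U T : Subgroup G}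
    [Fintype T] (hU : U.Normal) (hUT : U.IsComplement' T) (φ : U → ℂ)
    (hφ : ∀ v u : U, φ (v⁻¹ * u * v) = φ u) (u : U) :
    inducedChar U φ u = ∑ w : T, φ ⟨(w : G) * u * (w : G)⁻¹, hU.conj_mem u u.2 w⟩ := by
  classical
  have hmem (x : G) : x⁻¹ * u * x ∈ U := by simpa using hU.conj_mem u u.2 x⁻¹
  have hT : ∀ w : T, ∀ v : U, φ ⟨((v : G) * w)⁻¹ * u * (v * w), hmem _⟩ =
      φ ⟨((w⁻¹ : T) : G) * u * ((w⁻¹ : T) : G)⁻¹, hU.conj_mem u u.2 _⟩ := by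
    intro w v
    let v' : U := ⟨(w : G)⁻¹ * v * w, by simpa using hU.conj_mem v v.2 (w : G)⁻¹⟩
    rw [← hφ v' ⟨((w⁻¹ : T) : G) * u * ((w⁻¹ : T) : G)⁻¹, hU.conj_mem u u.2 _⟩]
    congr 1
    ext
    simp [v', mul_assoc]
  have hbij : Function.Bijective fun x : U × T => (x.1 : G) * x.2 := hUT
  simp only [inducedChar, hmem, dif_pos]
  rw [← (Equiv.ofBijective _ hbij).sum_comp, Fintype.sum_prod_type]
  simp only [Equiv.ofBijective_apply, hT]
  rw [Finset.sum_const, Finset.card_univ, nsmul_eq_mul, ← Nat.card_eq_fintype_card,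
    inv_mul_cancel_left₀ (Nat.cast_ne_zero.2 Nat.card_pos.ne')]
  exact Equiv.sum_comp (Equiv.inv T) fun w : T =>
    φ ⟨(w : G) * u * (w : G)⁻¹, hU.conj_mem u u.2 w⟩

theorem sum_units_addChar_mul {F : Type*} [Field F] [Fintype F] [DecidableEq F]
    {χ : AddChar F ℂ} (hχ : χ ≠ 1) (b : F) :
    ∑ c : Fˣ, χ (c * b) = (if b = 0 then (Fintype.card F : ℂ) else 0) - 1 := by
  have h := AddChar.sum_mulShift b (AddChar.IsPrimitive.of_ne_one hχ)
  rw [Fintype.sum_eq_add_sum_subtype_ne _ (0 : F),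
    ← (unitsEquivNeZero (G₀ := F)).sum_comp] at h
  simp only [unitsEquivNeZero_apply_coe, zero_mul, AddChar.map_zero_eq_one] at h
  rw [eq_sub_iff_add_eq', h]
  split_ifs <;> simp

theorem eq_zero_of_forall_addChar_mul_eq_one {F : Type*} [Field F] {χ : AddChar F ℂ}
    (hχ : χ ≠ 1) {b : F} (h : ∀ c : Fˣ, χ (c * b) = 1) : b = 0 := by
  by_contra hb
  refine hχ (DFunLike.ext _ _ fun a => ?_)
  rcases eq_or_ne a 0 with rfl | ha
  · simp
  · simpa [hb] using h (Units.mk0 a ha * (Units.mk0 b hb)⁻¹)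

/-- The affine action of a split extension `U ⋊ T` on `F`, where `U` acts by translations and `T`
by homotheties. -/
theorem exists_affine_action {F : Type*} [Field F] {G : Type*} [Group G] {U T : Subgroup G}
    (hU : U.Normal) (hUT : U.IsComplement' T) (γ : U → F)
    (hadd : ∀ x y, γ (x * y) = γ x + γ y) (e : T →* Fˣ)
    (hconj : ∀ (w : T) (x : U), γ ⟨(w : G) * x * (w : G)⁻¹, hU.conj_mem x x.2 w⟩ = e w * γ x) :
    ∃ α : G →* Equiv.Perm F, ∀ (u : U) (w : T) (a : F), α (u * w) a = γ u + e w * a := by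
  let fn : U →* Equiv.Perm F :=
    { toFun := fun u => Equiv.addLeft (γ u)
      map_one' := by
        have : γ 1 = 0 := by simpa using hadd 1 1
        ext a
        simp [this]
      map_mul' := fun u v => by
        ext a
        simp [hadd] }
  let fg : T →* Equiv.Perm F := (MulAction.toPermHom Fˣ F).comp e
  let E := SemidirectProduct.mulEquivSubgroup hUT
  refine ⟨(SemidirectProduct.lift fn fg fun w => ?_).comp E.symm.toMonoidHom, fun u w a => ?_⟩
  · ext u a
    obtain ⟨b, rfl⟩ := (fg w).surjective a
    have h := hconj w u
    simp only [MonoidHom.comp_apply, MulEquiv.coe_toMonoidHom, MulAut.conj_apply,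
      Equiv.Perm.mul_apply, Equiv.Perm.inv_def, Equiv.symm_apply_apply]
    change γ ⟨(w : G) * u * (w : G)⁻¹, hU.conj_mem u u.2 w⟩ + e w * b = e w * (γ u + b)
    rw [h, mul_add]
  · have : E.symm (u * w) = ⟨u, w⟩ := by
      rw [MulEquiv.symm_apply_eq]
      simp [E]
    simp [this, SemidirectProduct.lift, fn, fg, Units.smul_def]

/-- Let `q` be a prime power (realized as the cardinality of the finite field `F`),
`G` a finite group with a normal subgroup `U` and an element `t` of order `q - 1`
with `G = U⟨t⟩`, `U ∩ ⟨t⟩ = 1`.  Let `χ` be a nontrivial additive character of `F`,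
`ν` a generator of `Fˣ`, and `γ : U → F` a surjection such that `φ = χ ∘ γ` is a
homomorphism and `γ(t x t⁻¹) = ν · γ(x)`.  Then `ψ = Ind_U^G(φ)` is realizable
over `ℚ`. -/
theorem induced_gelfand_graev_realizable_over_rat
    {F : Type*} [Field F] [Fintype F]
    {G : Type*} [Group G] [Fintype G]
    (U : Subgroup G) (hU : U.Normal) (t : G)
    (ht : orderOf t = Fintype.card F - 1)
    (hUt : U ⊔ Subgroup.zpowers t = ⊤)
    (hUt' : U ⊓ Subgroup.zpowers t = ⊥)
    (χ : AddChar F ℂ) (hχ : ∃ a : F, χ a ≠ 1)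
    (ν : Fˣ) (hν : ∀ y : Fˣ, y ∈ Subgroup.zpowers ν)
    (γ : U → F) (hγ : Function.Surjective γ)
    (hhom : ∀ x y : U, χ (γ (x * y)) = χ (γ x) * χ (γ y))
    (hconj : ∀ x : U, γ ⟨t * (x : G) * t⁻¹, hU.conj_mem x.1 x.2 t⟩ = (ν : F) * γ x) :
    RealizableOverRat (inducedChar U fun x => χ (γ x)) := by
  classical
  have hχ1 : χ ≠ 1 := by
    obtain ⟨a, ha⟩ := hχ
    rintro rfl
    simp at ha
  have hUT : U.IsComplement' (Subgroup.zpowers t) := by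
    refine Subgroup.isComplement'_of_disjoint_and_mul_eq_univ (disjoint_iff.2 hUt') ?_
    rw [← Subgroup.normal_mul, hUt, Subgroup.coe_top]
  let e : Subgroup.zpowers t ≃* Fˣ := mulEquivOfOrderOfEq
    (g := ⟨t, Subgroup.mem_zpowers t⟩) (g' := ν) (by
      rintro ⟨_, k, rfl⟩
      exact ⟨k, rfl⟩) hν (by
      rw [Subgroup.orderOf_mk, ht, orderOf_eq_card_of_forall_mem_zpowers hν,
        Nat.card_eq_fintype_card, Fintype.card_units])
  have he : e ⟨t, Subgroup.mem_zpowers t⟩ = ν := mulEquivOfOrderOfEq_apply_gen _ _ _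
  have hconj' (w : Subgroup.zpowers t) (x : U) :
      γ ⟨(w : G) * x * (w : G)⁻¹, hU.conj_mem x x.2 w⟩ = e w * γ x := by
    obtain ⟨w, hw⟩ := w
    obtain ⟨n, rfl⟩ := mem_powers_iff_mem_zpowers.2 hw
    have hen : e ⟨t ^ n, hw⟩ = ν ^ n := by
      rw [← he, ← map_pow]
      rfl
    simp only [hen]
    clear hen
    change γ ⟨t ^ n * x * (t ^ n)⁻¹, hU.conj_mem x x.2 _⟩ = _
    clear hw
    induction n with
    | zero => simp
    | succ n ih =>
      have h := hconj ⟨t ^ n * x * (t ^ n)⁻¹, hU.conj_mem x x.2 _⟩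
      rw [ih] at h
      simpa [pow_succ', mul_assoc] using h
  have hadd (x y : U) : γ (x * y) = γ x + γ y := by
    rw [← sub_eq_zero]
    refine eq_zero_of_forall_addChar_mul_eq_one hχ1 fun c => ?_
    obtain ⟨w, rfl⟩ := e.surjective c
    have h := hhom ⟨(w : G) * x * (w : G)⁻¹, hU.conj_mem x x.2 w⟩
      ⟨(w : G) * y * (w : G)⁻¹, hU.conj_mem y y.2 w⟩
    rw [hconj', hconj', ← AddChar.map_add_eq_mul] at h
    have hxy := hconj' w (x * y)
    simp only [MulMemClass.mk_mul_mk, Subgroup.coe_mul, mul_assoc, inv_mul_cancel_left] at h hxy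
    rw [hxy] at h
    rw [mul_sub, AddChar.map_sub_eq_div, h, mul_add, div_self]
    exact (AddChar.val_isUnit χ _).ne_zero
  obtain ⟨α, hα⟩ := exists_affine_action hU hUT γ hadd e.toMonoidHom hconj'
  refine realizableOverRat_of_fixedPoints_sub_one (0 : F) α _ fun g => ?_
  obtain ⟨⟨u, w⟩, rfl⟩ := hUT.2 g
  simp only [hα, MulEquiv.coe_toMonoidHom]
  rcases eq_or_ne w 1 with rfl | hw
  · have hγ1 : γ 1 = 0 := by simpa using hadd 1 1
    have hinv (v u : U) : γ (v⁻¹ * u * v) = γ u := by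
      have h := hadd v⁻¹ v
      rw [inv_mul_cancel, hγ1] at h
      rw [hadd, hadd]
      linear_combination -h
    simp only [OneMemClass.coe_one, mul_one, map_one, Units.val_one, one_mul, add_eq_right]
    rw [inducedChar_apply_of_isComplement hU hUT _ (fun v u => by rw [hinv])]
    simp only [hconj']
    rw [e.bijective.sum_comp fun c : Fˣ => χ (c * γ u), sum_units_addChar_mul hχ1]
    split_ifs <;> simp
  · have hmem : (u * w : G) ∉ U := fun h => hw (by
      have : (w : G) ∈ U ⊓ Subgroup.zpowers t := ⟨(U.mul_mem_cancel_left u.2).1 h, w.2⟩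
      rw [hUt'] at this
      exact Subtype.ext this)
    have hew : 1 - (e w : F) ≠ 0 := by
      rw [sub_ne_zero, ne_comm, Ne, Units.val_eq_one, map_eq_one_iff e e.injective]
      exact hw
    have hfix (a : F) : γ u + e w * a = a ↔ a = γ u / (1 - e w) := by
      rw [eq_div_iff hew]
      constructor <;> intro h <;> linear_combination -h
    rw [inducedChar_eq_zero_of_notMem U hU _ hmem]
    simp [hfix]
end

section
/- Let G be a finite group, let K be a subfield of ℂ, and let χ be an irreducible character of G all of whose values lie in K. If there exists a character θ of G that is realizable over K and satisfies ⟨χ, θ⟩ = 1, then χ is realizable over K. -/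
open scoped BigOperators

/-- `χ : G → ℂ` is the character of a finite-dimensional complex representation
of `G`. -/
def IsCharacter (G : Type*) [Group G] (χ : G → ℂ) : Prop :=
  ∃ (n : ℕ) (ρ : Representation ℂ G (Fin n → ℂ)),
    ∀ g, χ g = LinearMap.trace ℂ (Fin n → ℂ) (ρ g)

/-- The inner product `⟨α, β⟩ = |G|⁻¹ ∑ α(g) conj(β(g))` of class functions. -/
noncomputable def charInner {G : Type*} [Group G] [Fintype G] (α β : G → ℂ) : ℂ :=
  (Fintype.card G : ℂ)⁻¹ * ∑ g : G, α g * (starRingEnd ℂ) (β g)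

/-- A class function `χ : G → ℂ` is realizable over the subfield `K ⊆ ℂ` if it is
the character of a finite-dimensional representation of `G` defined over `K`
(equivalently, of a matrix representation with entries in `K`, whose extension
of scalars to `ℂ` then has character `χ`). -/
def RealizableOver {G : Type*} [Group G] (K : Subfield ℂ) (χ : G → ℂ) : Prop :=
  ∃ (n : ℕ) (ρ : G →* Matrix (Fin n) (Fin n) K), ∀ g, χ g = ((ρ g).trace : ℂ)

section ClassFunctions

variable {G V : Type*} [Group G] [AddCommGroup V] [Module ℂ V]
  [FiniteDimensional ℂ V]

/-- An endomorphism commuting with an irreducible complex representation is a scalar. -/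
theorem exists_eq_smul_one_of_commute (σ : Representation ℂ G V) [σ.IsIrreducible]
    (T : Module.End ℂ V) (hT : ∀ g, Commute T (σ g)) : ∃ c : ℂ, T = c • 1 := by
  let T' : σ.IntertwiningMap σ :=
    T.intertwiningMap_of_isIntertwiningMap σ σ fun g v ↦ LinearMap.congr_fun (hT g) v
  obtain ⟨c, hc⟩ :=
    (Representation.IsIrreducible.algebraMap_intertwiningMap_bijective_of_isAlgClosed
      (ρ := σ) (k := ℂ)).2 T'
  refine ⟨c, LinearMap.ext fun v ↦ ?_⟩
  exact (DFunLike.congr_fun hc v).symm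

variable [Fintype G]

/-- Convolving a class function with an irreducible character rescales that character. -/
theorem character_one_mul_sum_mul_character (σ : Representation ℂ G V) [σ.IsIrreducible]
    (f : G → ℂ) (hf : ∀ a b, f (a * b) = f (b * a)) (g : G) :
    σ.character 1 * ∑ k, f k * σ.character (k⁻¹ * g) =
      (∑ k, f k * σ.character k⁻¹) * σ.character g := by
  obtain ⟨c, hc⟩ := exists_eq_smul_one_of_commute σ (∑ k, f k • σ k⁻¹) fun a ↦ by
    simp only [Commute, SemiconjBy, Finset.sum_mul, Finset.mul_sum, smul_mul_assoc,
      mul_smul_comm, ← map_mul]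
    refine Fintype.sum_equiv (MulAut.conj a⁻¹).toEquiv _ _ fun k ↦ ?_
    have : f (a⁻¹ * (k * a)) = f k := by rw [hf, mul_inv_cancel_right]
    simp [this, mul_assoc]
  have h (g : G) : ∑ k, f k * σ.character (k⁻¹ * g) = c * σ.character g := by
    have := congrArg (fun T ↦ LinearMap.trace ℂ V (T * σ g)) hc
    simpa [Finset.sum_mul, ← map_mul, Representation.character] using this
  have h1 := h 1
  simp only [mul_one] at h1
  rw [h, h1]
  ring

/-- An irreducible complex character has norm one. -/
theorem sum_character_mul_character_inv (σ : Representation ℂ G V) [σ.IsIrreducible] :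
    ∑ k, σ.character k * σ.character k⁻¹ = Fintype.card G := by
  have hG : (Nat.card G : ℂ) ≠ 0 := by simp
  let := invertibleOfNonzero hG
  have h := Representation.card_inv_mul_sum_char_mul_char_eq_finrank σ σ
  rw [Representation.IsIrreducible.finrank_intertwiningMap_self, inv_mul_eq_iff_eq_mul₀ hG] at h
  simpa using h

end ClassFunctions

open Matrix ComplexOrder in
/-- The trace of a complex matrix representation of a finite group is conjugated by inversion. -/
theorem star_trace_eq_trace_inv {G : Type*} [Group G] [Fintype G] {ι : Type*} [Fintype ι]
    [DecidableEq ι] (ρ : G →* Matrix ι ι ℂ) (g : G) : star (ρ g).trace = (ρ g⁻¹).trace := by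
  set M : Matrix ι ι ℂ := ∑ h, (ρ h)ᴴ * ρ h with hMdef
  have hM : (ρ g)ᴴ * M * ρ g = M := by
    simp only [hMdef, Finset.mul_sum, Finset.sum_mul]
    refine Fintype.sum_equiv (Equiv.mulRight g) _ _ fun h ↦ ?_
    simp [conjTranspose_mul, mul_assoc]
  have hpos : M.PosDef := by
    classical
    rw [hMdef, ← Finset.add_sum_erase _ _ (Finset.mem_univ 1)]
    refine PosDef.add_posSemidef ?_
      (posSemidef_sum _ fun h _ ↦ posSemidef_conjTranspose_mul_self _)
    simpa using PosDef.one
  have hdet := (isUnit_iff_isUnit_det M).1 hpos.isUnit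
  have hgg : ρ g * ρ g⁻¹ = 1 := by rw [← map_mul, mul_inv_cancel, map_one]
  have key : (ρ g)ᴴ = M * ρ g⁻¹ * M⁻¹ := by
    rw [← mul_nonsing_inv_cancel_right M ((ρ g)ᴴ) hdet]
    congr 1
    rw [← mul_one ((ρ g)ᴴ * M), ← hgg, ← mul_assoc, hM]
  rw [← trace_conjTranspose, key, trace_mul_comm, ← mul_assoc, nonsing_inv_mul _ hdet, one_mul]

/-- The image of an idempotent commuting with a matrix representation carries a matrix
representation over the same field. -/
theorem exists_matrix_rep_of_isIdempotentElem {G K ι : Type*} [Group G] [Field K] [Fintype ι]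
    [DecidableEq ι] (ρ : G →* Matrix ι ι K) (P : Matrix ι ι K) (hP : IsIdempotentElem P)
    (hcomm : ∀ g, Commute P (ρ g)) :
    ∃ (m : ℕ) (τ : G →* Matrix (Fin m) (Fin m) K), ∀ g, (τ g).trace = (ρ g * P).trace := by
  let p : Module.End K (ι → K) := Matrix.toLin' P
  have hp : ∀ v ∈ p.range, p v = v := by
    rintro _ ⟨v, rfl⟩
    change (p * p) v = p v
    rw [Module.End.mul_eq_comp, ← Matrix.toLin'_mul, hP]
  let σ : Representation K G (ι → K) := (Matrix.toLinAlgEquiv' : _ ≃ₐ[K] _).toMonoidHom.comp ρ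
  have hσ (g : G) : σ g = Matrix.toLin' (ρ g) := rfl
  let W : Subrepresentation σ := ⟨p.range, by
    rintro g _ ⟨v, rfl⟩
    refine ⟨σ g v, ?_⟩
    simp only [hσ, p, ← LinearMap.comp_apply, ← Matrix.toLin'_mul, (hcomm g).eq]⟩
  let b := Module.finBasis K W.toSubmodule
  refine ⟨_, (LinearMap.toMatrixAlgEquiv b).toMonoidHom.comp W.toRepresentation, fun g ↦ ?_⟩
  let q : (ι → K) →ₗ[K] W.toSubmodule := p.rangeRestrict
  have h1 : ((W.toRepresentation g) ∘ₗ q) ∘ₗ W.toSubmodule.subtype = W.toRepresentation g := by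
    ext w : 1
    have : q w = w := Subtype.ext (hp w w.2)
    simp [this]
  have h2 : W.toSubmodule.subtype ∘ₗ ((W.toRepresentation g) ∘ₗ q) = Matrix.toLin' (ρ g * P) := by
    rw [Matrix.toLin'_mul]
    rfl
  rw [← Matrix.trace_toLin'_eq (ρ g * P), ← h2, LinearMap.trace_comp_comm', h1,
    LinearMap.trace_eq_matrix_trace K b]
  rfl

/-- If a class function `φ` over `K` is idempotent under convolution scaled by `c`, then it cuts out
of any matrix representation `ρ` over `K` a matrix representation over `K` whose character is the
scaled convolution of `φ` with the character of `ρ`. -/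
theorem exists_matrix_rep_of_convolution {G K ι : Type*} [Group G] [Fintype G] [Field K]
    [Fintype ι] [DecidableEq ι] (ρ : G →* Matrix ι ι K) (φ : G → K) (c : K)
    (hφ : ∀ a b, φ (a * b) = φ (b * a)) (hconv : ∀ g, c * ∑ k, φ k * φ (k⁻¹ * g) = φ g) :
    ∃ (m : ℕ) (τ : G →* Matrix (Fin m) (Fin m) K),
      ∀ g, (τ g).trace = c * ∑ k, (ρ k).trace * φ (k⁻¹ * g) := by
  set P : Matrix ι ι K := c • ∑ h, φ h⁻¹ • ρ h with hPdef
  have hmul (g : G) : ρ g * P = c • ∑ k, φ (k⁻¹ * g) • ρ k := by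
    simp only [hPdef, mul_smul_comm, Finset.mul_sum, ← map_mul]
    congr 1
    refine Fintype.sum_equiv (Equiv.mulLeft g) _ _ fun h ↦ ?_
    simp
  have hP : IsIdempotentElem P := by
    have : P * P = c • ∑ h, φ h⁻¹ • (ρ h * P) := by
      conv_lhs => rw [hPdef, smul_mul_assoc, Finset.sum_mul, ← hPdef]
      simp only [smul_mul_assoc]
    rw [IsIdempotentElem, this]
    simp only [hmul, Finset.smul_sum, smul_smul]
    rw [Finset.sum_comm, hPdef, Finset.smul_sum]
    refine Finset.sum_congr rfl fun g _ ↦ ?_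
    rw [← Finset.sum_smul, ← hconv g⁻¹, smul_smul, Finset.mul_sum, Finset.mul_sum]
    congr 1
    refine Fintype.sum_equiv (Equiv.inv G) _ _ fun h ↦ ?_
    simp only [Equiv.inv_apply, inv_inv, hφ h g⁻¹]
    ring
  have hcomm (g : G) : Commute P (ρ g) := by
    rw [commute_iff_eq, hmul]
    simp only [hPdef, smul_mul_assoc, Finset.sum_mul, ← map_mul]
    congr 1
    refine Fintype.sum_equiv (Equiv.mulRight g) _ _ fun h ↦ ?_
    simp [hφ _ g]
  obtain ⟨m, τ, hτ⟩ := exists_matrix_rep_of_isIdempotentElem ρ P hP hcomm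
  refine ⟨m, τ, fun g ↦ ?_⟩
  simp [hτ, hmul, Matrix.trace_sum, mul_comm]

/-- Let `G` be a finite group, `K` a subfield of `ℂ`, and `χ` an irreducible
character of `G` with all values in `K`.  If some character `θ` of `G` is
realizable over `K` and satisfies `⟨χ, θ⟩ = 1`, then `χ` is realizable over
`K`. -/
theorem realizable_of_multiplicity_one
    {G : Type*} [Group G] [Fintype G] (K : Subfield ℂ)
    (χ : G → ℂ) (hχ : IsIrreducibleCharacter G χ)
    (hvals : ∀ g : G, χ g ∈ K)
    (θ : G → ℂ) (hθ : IsCharacter G θ)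
    (hθK : RealizableOver K θ)
    (hmult : charInner χ θ = 1) :
    RealizableOver K χ := by
  obtain ⟨n, σ, hσ, hn, hirr⟩ := hχ
  obtain ⟨d, ρ, hρ⟩ := hθK
  have hσχ : σ.character = χ := funext fun g ↦ (hσ g).symm
  have : NeZero n := ⟨hn⟩
  have : σ.IsIrreducible :=
    { exists_pair_ne := ⟨⊥, ⊤, fun h ↦ bot_ne_top (α := Submodule ℂ (Fin n → ℂ))
        (congrArg Subrepresentation.toSubmodule h)⟩
      eq_bot_or_eq_top W := (hirr W.toSubmodule fun g w hw ↦ W.apply_mem_toSubmodule g hw).imp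
        (fun h ↦ Subrepresentation.toSubmodule_injective h)
        fun h ↦ Subrepresentation.toSubmodule_injective h }
  have hG : (Fintype.card G : ℂ) ≠ 0 := by simp
  have hclass : ∀ a b, χ (a * b) = χ (b * a) := fun a b ↦ by
    rw [← hσχ, σ.char_mul_comm]
  have hθclass : ∀ a b, θ (a * b) = θ (b * a) := fun a b ↦ by
    rw [hρ, hρ, map_mul, map_mul, Matrix.trace_mul_comm]
  have hconj (g : G) : (starRingEnd ℂ) (θ g) = θ g⁻¹ := by
    have h := star_trace_eq_trace_inv ((K.subtype.mapMatrix : _ →+* _).toMonoidHom.comp ρ) g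
    have htr (g : G) :
        (((K.subtype.mapMatrix : _ →+* _).toMonoidHom.comp ρ) g).trace = θ g := by
      rw [hρ]
      exact (AddMonoidHom.map_trace K.subtype (ρ g)).symm
    rwa [htr, htr] at h
  have hχχ := sum_character_mul_character_inv σ
  have hθχ : ∑ k, θ k * χ k⁻¹ = Fintype.card G := by
    rw [charInner, inv_mul_eq_one₀ hG] at hmult
    rw [hmult]
    refine Fintype.sum_equiv (Equiv.inv G) _ _ fun k ↦ ?_
    simp [hconj, mul_comm]
  have hconv := character_one_mul_sum_mul_character σ χ hclass
  have hθconv := character_one_mul_sum_mul_character σ θ hθclass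
  simp only [hσχ] at hχχ hconv hθconv
  rw [hχχ] at hconv
  rw [hθχ] at hθconv
  obtain ⟨m, τ, hτ⟩ := exists_matrix_rep_of_convolution ρ (fun g ↦ (⟨χ g, hvals g⟩ : K))
    ((Fintype.card G : K)⁻¹ * ⟨χ 1, hvals 1⟩) (fun a b ↦ Subtype.ext (hclass a b)) fun g ↦ by
      apply Subtype.ext
      push_cast
      rw [mul_assoc, hconv, inv_mul_cancel_left₀ hG]
  refine ⟨m, τ, fun g ↦ ?_⟩
  rw [hτ]
  push_cast
  simp only [← hρ]
  rw [mul_assoc, hθconv, inv_mul_cancel_left₀ hG]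
end

section
/- Let G be a finite group, N a subgroup of G, K a subfield of ℂ, and χ an irreducible character of G all of whose values lie in K and whose restriction Res_N(χ) to N is again an irreducible character of N. Then χ is realizable over K if and only if Res_N(χ) is realizable over K. -/
open scoped BigOperators

open Module in
/-- An irreducible complex representation of a finite group is isomorphic to every
finite-dimensional representation with the same character. -/
theorem exists_equiv_of_character_eq {H V W : Type*} [Group H] [Finite H]
    [AddCommGroup V] [Module ℂ V] [FiniteDimensional ℂ V] [Nontrivial V]
    [AddCommGroup W] [Module ℂ W] [FiniteDimensional ℂ W]
    (π : Representation ℂ H V) (σ : Representation ℂ H W)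
    (hπ : ∀ U : Submodule ℂ V, (∀ (h : H), ∀ v ∈ U, π h v ∈ U) → U = ⊥ ∨ U = ⊤)
    (hchar : ∀ h, LinearMap.trace ℂ V (π h) = LinearMap.trace ℂ W (σ h)) :
    ∃ e : V ≃ₗ[ℂ] W, ∀ h v, e (π h v) = σ h (e v) := by
  have := Fintype.ofFinite H
  have hcard : (Nat.card H : ℂ) ≠ 0 := Nat.cast_ne_zero.mpr Nat.card_pos.ne'
  have : Invertible (Nat.card H : ℂ) := invertibleOfNonzero hcard
  have hrank : finrank ℂ V = finrank ℂ W := by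
    simpa using hchar 1
  have hhom : finrank ℂ (Representation.IntertwiningMap π σ) =
      finrank ℂ (Representation.IntertwiningMap π π) := by
    have h₁ := Representation.card_inv_mul_sum_char_mul_char_eq_finrank π σ
    have h₂ := Representation.card_inv_mul_sum_char_mul_char_eq_finrank π π
    have hc : σ.character = π.character := funext fun h ↦ (hchar h).symm
    rw [hc] at h₁
    exact_mod_cast h₁.symm.trans h₂
  have hfin (X : Type _) [AddCommGroup X] [Module ℂ X] [FiniteDimensional ℂ X]
      (τ : Representation ℂ H X) : FiniteDimensional ℂ (Representation.IntertwiningMap π τ) :=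
    Module.Finite.equiv (Representation.invariantsEquivIntertwiningMap π τ)
  have := hfin V π
  have hid : (Representation.IntertwiningMap.id π) ≠ 0 := by
    obtain ⟨v, hv⟩ := exists_ne (0 : V)
    intro h0
    apply hv
    simpa using congrArg (fun f : Representation.IntertwiningMap π π ↦ f v) h0
  have : Nontrivial (Representation.IntertwiningMap π π) := ⟨_, _, hid⟩
  have hpos : 0 < finrank ℂ (Representation.IntertwiningMap π σ) := hhom ▸ finrank_pos
  have := nontrivial_of_finrank_pos hpos
  obtain ⟨f, hf⟩ := exists_ne (0 : Representation.IntertwiningMap π σ)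
  have hcomm (h : H) (v : V) : f.toLinearMap (π h v) = σ h (f.toLinearMap v) :=
    LinearMap.congr_fun (f.isIntertwining' h) v
  have hker : LinearMap.ker f.toLinearMap = ⊥ := by
    refine (hπ _ fun h v hv ↦ ?_).resolve_right fun htop ↦ hf ?_
    · rw [LinearMap.mem_ker] at hv ⊢
      rw [hcomm, hv, map_zero]
    · ext v
      exact LinearMap.congr_fun (LinearMap.ker_eq_top.mp htop) v
  exact ⟨LinearEquiv.ofInjectiveOfFinrankEq f.toLinearMap (LinearMap.ker_eq_bot.mp hker) hrank,
    hcomm⟩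

/-- **Schur's lemma**: an endomorphism commuting with an irreducible complex representation is a
scalar. -/
theorem exists_eq_smul_one_of_commute_s6 {H V : Type*} [Group H]
    [AddCommGroup V] [Module ℂ V] [FiniteDimensional ℂ V] [Nontrivial V]
    (π : Representation ℂ H V)
    (hπ : ∀ U : Submodule ℂ V, (∀ (h : H), ∀ v ∈ U, π h v ∈ U) → U = ⊥ ∨ U = ⊤)
    (f : Module.End ℂ V) (hf : ∀ h, Commute f (π h)) : ∃ c : ℂ, f = c • 1 := by
  obtain ⟨c, hc⟩ := Module.End.exists_eigenvalue f
  refine ⟨c, ?_⟩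
  have htop : f.eigenspace c = ⊤ := by
    refine (hπ _ fun h v hv ↦ ?_).resolve_left hc
    rw [Module.End.mem_eigenspace_iff] at hv ⊢
    rw [← Module.End.mul_apply, (hf h).eq, Module.End.mul_apply, hv, map_smul]
  ext v
  exact Module.End.mem_eigenspace_iff.mp (htop ▸ Submodule.mem_top)

/-- Schur orthogonality in matrix form: if only scalar matrices commute with a matrix
representation `T`, then averaging the conjugates of `A` yields the normalized trace of `A`. -/
theorem card_mul_sum_conj_eq_card_mul_trace {H ι : Type*} [Group H] [Fintype H]
    [Fintype ι] [DecidableEq ι] (T : H →* Matrix ι ι ℂ)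
    (hT : ∀ A, (∀ h, Commute A (T h)) → ∃ c : ℂ, A = c • 1) (A : Matrix ι ι ℂ) :
    (Fintype.card ι : ℂ) • ∑ h, T h⁻¹ * A * T h =
      ((Fintype.card H : ℂ) * A.trace) • (1 : Matrix ι ι ℂ) := by
  obtain ⟨c, hc⟩ := hT (∑ h, T h⁻¹ * A * T h) fun y ↦ by
    rw [commute_iff_eq, Finset.sum_mul, Finset.mul_sum]
    refine Fintype.sum_equiv (Equiv.mulRight y) _ _ fun x ↦ ?_
    simp only [Equiv.coe_mulRight, mul_inv_rev, map_mul, ← mul_assoc]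
    rw [← map_mul, mul_inv_cancel, map_one, one_mul]
  have htr := congrArg Matrix.trace hc
  have hterm (x : H) : (T x⁻¹ * A * T x).trace = A.trace := by
    rw [Matrix.trace_mul_comm, ← mul_assoc, ← map_mul, mul_inv_cancel, map_one, one_mul]
  simp only [Matrix.trace_sum, hterm, Matrix.trace_smul, Matrix.trace_one, Finset.sum_const,
    Finset.card_univ, nsmul_eq_mul, smul_eq_mul] at htr
  rw [hc, htr, smul_smul, mul_comm]

/-- If only scalar matrices commute with the matrix representation `T`, then a matrix `M` is
recovered from the traces of the products `M * T h`. -/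
theorem card_mul_sum_mul_trace_eq {H ι : Type*} [Group H] [Fintype H]
    [Fintype ι] [DecidableEq ι] (T : H →* Matrix ι ι ℂ)
    (hT : ∀ A, (∀ h, Commute A (T h)) → ∃ c : ℂ, A = c • 1) (M : Matrix ι ι ℂ) (k i : ι) :
    (Fintype.card ι : ℂ) * ∑ h, T h⁻¹ k i * (M * T h).trace = (Fintype.card H : ℂ) * M k i := by
  have horth (j l : ι) : (Fintype.card ι : ℂ) * ∑ h, T h⁻¹ k i * T h j l =
      if i = j ∧ k = l then (Fintype.card H : ℂ) else 0 := by
    have h := congrFun₂ (card_mul_sum_conj_eq_card_mul_trace T hT (Matrix.single i j 1)) k l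
    have hentry (x : H) : (T x⁻¹ * Matrix.single i j (1 : ℂ) * T x : Matrix ι ι ℂ) k l =
        T x⁻¹ k i * T x j l := by
      rw [Matrix.mul_apply, Finset.sum_eq_single j]
      · simp
      · intro b _ hb
        simp [Matrix.mul_single_apply_of_ne, hb]
      · simp
    simp only [Matrix.smul_apply, Matrix.sum_apply, hentry, smul_eq_mul] at h
    rw [h]
    by_cases hij : i = j <;> by_cases hkl : k = l <;>
      simp [hij, hkl, Matrix.one_apply, Matrix.trace_single_eq_of_ne]
  calc (Fintype.card ι : ℂ) * ∑ h, T h⁻¹ k i * (M * T h).trace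
      = ∑ l, ∑ j, M l j * ((Fintype.card ι : ℂ) * ∑ h, T h⁻¹ k i * T h j l) := by
        simp only [Matrix.trace, Matrix.diag_apply, Matrix.mul_apply, Finset.mul_sum]
        rw [Finset.sum_comm]
        refine Finset.sum_congr rfl fun l _ ↦ ?_
        rw [Finset.sum_comm]
        refine Finset.sum_congr rfl fun j _ ↦ Finset.sum_congr rfl fun h _ ↦ ?_
        ring
    _ = (Fintype.card H : ℂ) * M k i := by
        simp only [horth, ite_and, mul_ite, mul_zero, Finset.sum_ite_eq, Finset.mem_univ, if_true]
        ring

/-- A matrix representation of `G` whose restriction to a subgroup `N` has only scalar commutant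
and entries in `K`, and whose character has values in `K`, has all its entries in `K`. -/
theorem entries_mem_of_trace_mem {G ι : Type*} [Group G] [Fintype ι] [DecidableEq ι]
    (N : Subgroup G) [Finite N] (K : Subfield ℂ) (R : G →* Matrix ι ι ℂ)
    (hR : ∀ A, (∀ x : N, Commute A (R x)) → ∃ c : ℂ, A = c • 1)
    (hN : ∀ (x : N) (i j : ι), R x i j ∈ K) (htr : ∀ g, (R g).trace ∈ K) (g : G) (i j : ι) :
    R g i j ∈ K := by
  have := Fintype.ofFinite N
  have key := card_mul_sum_mul_trace_eq (R.comp N.subtype) hR (R g) i j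
  have hcard : (Fintype.card N : ℂ) ≠ 0 := Nat.cast_ne_zero.mpr Fintype.card_ne_zero
  rw [mul_comm (Fintype.card N : ℂ), ← div_eq_iff hcard] at key
  rw [← key]
  refine div_mem (mul_mem (natCast_mem K _) (sum_mem fun x _ ↦ mul_mem (hN x⁻¹ i j) ?_))
    (natCast_mem K _)
  simpa using htr (g * x)

/-- A matrix representation over `ℂ` with entries in `K` makes its character realizable. -/
theorem RealizableOver.of_entries_mem {G : Type*} [Group G] {K : Subfield ℂ} {m : ℕ}
    (R : G →* Matrix (Fin m) (Fin m) ℂ) (hR : ∀ g i j, R g i j ∈ K) :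
    RealizableOver K fun g ↦ (R g).trace := by
  have hinj : Function.Injective (K.subtype.mapMatrix (m := Fin m)) :=
    Matrix.map_injective K.subtype.injective
  let S (g : G) : Matrix (Fin m) (Fin m) K := Matrix.of fun i j ↦ ⟨R g i j, hR g i j⟩
  have hS (g : G) : K.subtype.mapMatrix (S g) = R g := rfl
  refine ⟨m, ⟨⟨S, hinj ?_⟩, fun g h ↦ hinj ?_⟩, fun g ↦ ?_⟩
  · rw [hS, map_one, map_one]
  · rw [map_mul, hS, hS, hS, map_mul]
  · change _ = K.subtype (S g).trace
    rw [AddMonoidHom.map_trace K.subtype]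
    rfl

/-- Let `G` be a finite group, `N` a subgroup, `K` a subfield of `ℂ`, and `χ` an
irreducible character of `G` with all values in `K` whose restriction to `N` is
again irreducible.  Then `χ` is realizable over `K` iff its restriction to `N`
is realizable over `K`. -/
theorem realizable_iff_restriction_realizable
    {G : Type*} [Group G] [Fintype G]
    (N : Subgroup G) (K : Subfield ℂ)
    (χ : G → ℂ) (hχ : IsIrreducibleCharacter G χ)
    (hvals : ∀ g : G, χ g ∈ K)
    (hres : IsIrreducibleCharacter N (fun x : N => χ (x : G))) :
    RealizableOver K χ ↔ RealizableOver K (fun x : N => χ (x : G)) := by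
  constructor
  · rintro ⟨n, ρ, hρ⟩
    exact ⟨n, ρ.comp N.subtype, fun x ↦ hρ x⟩
  · rintro ⟨m, τ, hτ⟩
    obtain ⟨n, ρ, hρ, -, -⟩ := hχ
    obtain ⟨d, π, hπ, hd, hirr⟩ := hres
    have : NeZero d := ⟨hd⟩
    let τC : Representation ℂ N (Fin m → ℂ) :=
      (Matrix.toLinAlgEquiv' : Matrix (Fin m) (Fin m) ℂ ≃ₐ[ℂ] _).toMonoidHom.comp
        ((K.subtype.mapMatrix : Matrix (Fin m) (Fin m) K →+* _).toMonoidHom.comp τ)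
    obtain ⟨e₁, he₁⟩ := exists_equiv_of_character_eq π (ρ.comp N.subtype) hirr
      fun x ↦ (hπ x).symm.trans (hρ x)
    obtain ⟨e₂, he₂⟩ := exists_equiv_of_character_eq π τC hirr fun x ↦ by
      rw [← hπ x, hτ x]
      change K.subtype (τ x).trace = LinearMap.trace ℂ _ (Matrix.toLin' (K.subtype.mapMatrix (τ x)))
      rw [Matrix.trace_toLin'_eq, AddMonoidHom.map_trace K.subtype]
      rfl
    let e := e₁.symm.trans e₂
    let R : G →* Matrix (Fin m) (Fin m) ℂ :=
      (LinearMap.toMatrixAlgEquiv' : _ ≃ₐ[ℂ] Matrix (Fin m) (Fin m) ℂ).toMonoidHom.comp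
        ((e.conjRingEquiv : _ ≃+* _).toMonoidHom.comp ρ)
    have hRdef (g : G) : R g = LinearMap.toMatrix' (e.conj (ρ g)) := rfl
    have hconj (x : N) : e₂.conj (π x) = Matrix.toLin' (K.subtype.mapMatrix (τ x)) := by
      refine LinearMap.ext fun v ↦ ?_
      obtain ⟨w, rfl⟩ := e₂.surjective v
      rw [LinearEquiv.conj_apply_apply, e₂.symm_apply_apply]
      exact he₂ x w
    have hρπ (x : N) : e₁.symm.conj (ρ x) = π x := by
      refine LinearMap.ext fun v ↦ ?_
      rw [LinearEquiv.conj_apply_apply, LinearEquiv.symm_symm, LinearEquiv.symm_apply_eq]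
      exact (he₁ x v).symm
    have hRN (x : N) : R x = K.subtype.mapMatrix (τ x) := by
      rw [hRdef, show e.conj (ρ x) = e₂.conj (e₁.symm.conj (ρ x)) from rfl, hρπ, hconj,
        LinearMap.toMatrix'_toLin']
    have htr (g : G) : (R g).trace = χ g := by
      rw [hRdef, hρ, ← LinearMap.trace_conj' (ρ g) e,
        LinearMap.trace_eq_matrix_trace ℂ (Pi.basisFun ℂ (Fin m))]
      rfl
    obtain rfl : χ = fun g ↦ (R g).trace := funext fun g ↦ (htr g).symm
    refine RealizableOver.of_entries_mem R (entries_mem_of_trace_mem N K R ?_ ?_ hvals)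
    · intro A hA
      have hcomm (x : N) : Commute (e₂.symm.conj (Matrix.toLin' A)) (π x) := by
        have h := (hA x).map (Matrix.toLinAlgEquiv' : Matrix (Fin m) (Fin m) ℂ ≃ₐ[ℂ] _)
        have hmap := h.map e₂.symm.conjRingEquiv
        have hπR : e₂.symm.conjRingEquiv (Matrix.toLinAlgEquiv' (R x)) = π x := by
          rw [hRN]
          exact (congrArg e₂.symm.conj (hconj x)).symm.trans (e₂.conj.symm_apply_apply (π x))
        rwa [hπR] at hmap
      obtain ⟨c, hc⟩ := exists_eq_smul_one_of_commute_s6 π hirr _ hcomm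
      refine ⟨c, Matrix.toLin'.injective ?_⟩
      have h := congrArg e₂.conj hc
      rw [map_smul, Module.End.one_eq_id, LinearEquiv.conj_id] at h
      rw [map_smul, Matrix.toLin'_one, ← h]
      exact (e₂.conj.apply_symm_apply _).symm
    · intro x i j
      rw [hRN]
      exact (τ x i j).2
end

section
/- Let G be a finite group containing a normal subgroup U and an element t of order 2m such that G = U⟨t⟩ and U ∩ ⟨t⟩ = {1}. Let φ : U → ℂ^× be a linear character of U such that φ(t^m x t^{-m}) = φ(x) for all x ∈ U, while the m conjugate characters x ↦ φ(t^i x t^{-i}), for 0 ≤ i < m, are pairwise distinct. Then Ind_U^G(φ) = ψ_1 + ψ_2, where ψ_1 and ψ_2 are two distinct irreducible characters of G, each of degree m. -/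
open scoped BigOperators

/-- The extension by zero to `G` of a linear character of the subgroup `U`. -/
noncomputable def extendZero {G : Type*} [Group G] (U : Subgroup G) (φ : U →* ℂˣ) (g : G) : ℂ :=
  open scoped Classical in if h : g ∈ U then (φ ⟨g, h⟩ : ℂ) else 0

section ExtendZero

variable {G : Type*} [Group G] {U : Subgroup G} {φ : U →* ℂˣ}

theorem extendZero_of_mem {g : G} (h : g ∈ U) : extendZero U φ g = φ ⟨g, h⟩ := by
  simp [extendZero, h]

theorem extendZero_of_notMem {g : G} (h : g ∉ U) : extendZero U φ g = 0 := by
  simp [extendZero, h]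

theorem extendZero_one : extendZero U φ 1 = 1 := by
  rw [extendZero_of_mem U.one_mem]
  exact congrArg Units.val (map_one φ)

theorem extendZero_mul {g u : G} (hu : u ∈ U) :
    extendZero U φ (g * u) = extendZero U φ g * extendZero U φ u := by
  by_cases hg : g ∈ U
  · rw [extendZero_of_mem (U.mul_mem hg hu), extendZero_of_mem hg, extendZero_of_mem hu,
      ← Units.val_mul, ← map_mul]
    rfl
  · rw [extendZero_of_notMem hg, zero_mul, extendZero_of_notMem]
    rwa [U.mul_mem_cancel_right hu]

theorem extendZero_mul' {g u : G} (hu : u ∈ U) :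
    extendZero U φ (u * g) = extendZero U φ u * extendZero U φ g := by
  by_cases hg : g ∈ U
  · exact extendZero_mul hg
  · rw [extendZero_of_notMem hg, mul_zero, extendZero_of_notMem]
    rwa [U.mul_mem_cancel_left hu]

theorem extendZero_conj_of_mem {g u : G} (hu : u ∈ U) :
    extendZero U φ (u⁻¹ * g * u) = extendZero U φ g := by
  rw [extendZero_mul hu, extendZero_mul' (U.inv_mem hu), mul_right_comm,
    ← extendZero_mul hu, inv_mul_cancel, extendZero_one, one_mul]

theorem extendZero_conj_of_fixed [hU : U.Normal] {s : G}
    (hfix : ∀ x : U, φ ⟨s * (x : G) * s⁻¹, hU.conj_mem x.1 x.2 s⟩ = φ x) (g : G) :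
    extendZero U φ (s * g * s⁻¹) = extendZero U φ g := by
  by_cases hg : g ∈ U
  · rw [extendZero_of_mem hg, extendZero_of_mem (hU.conj_mem g hg s), hfix ⟨g, hg⟩]
  · rw [extendZero_of_notMem hg, extendZero_of_notMem]
    rwa [← hU.mem_comm_iff, inv_mul_cancel_left]

theorem inducedChar_eq_sum_extendZero [Fintype G] (g : G) :
    inducedChar U (fun x => (φ x : ℂ)) g =
      (Nat.card U : ℂ)⁻¹ * ∑ x : G, extendZero U φ (x⁻¹ * g * x) := rfl

/-- The extension by zero to `G` of the linear character of `U ∪ Us` that restricts to `φ` on `U`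
and takes the value `ε` at the involution `s`. -/
noncomputable def extendInvolution (φ : U →* ℂˣ) (s : G) (ε : ℂ) (g : G) : ℂ :=
  extendZero U φ g + ε * extendZero U φ (g * s)

variable {s : G} {ε : ℂ}

theorem extendInvolution_of_mem (hs : s ∉ U) {u : G} (hu : u ∈ U) :
    extendInvolution φ s ε u = extendZero U φ u := by
  rw [extendInvolution, extendZero_of_notMem (g := u * s), mul_zero, add_zero]
  rwa [U.mul_mem_cancel_left hu]

theorem extendInvolution_eq_zero {g : G} (hg : g ∉ U) (hgs : g * s ∉ U) :
    extendInvolution φ s ε g = 0 := by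
  simp [extendInvolution, extendZero_of_notMem, hg, hgs]

theorem extendInvolution_mul_involution (hss : s * s = 1) (hε : ε * ε = 1) (g : G) :
    extendInvolution φ s ε (g * s) = ε * extendInvolution φ s ε g := by
  rw [extendInvolution, extendInvolution, mul_assoc, hss, mul_one, mul_add, ← mul_assoc, hε,
    one_mul, add_comm]

theorem extendInvolution_mul_of_mem [hU : U.Normal] (hss : s * s = 1)
    (hfix : ∀ x : U, φ ⟨s * (x : G) * s⁻¹, hU.conj_mem x.1 x.2 s⟩ = φ x) {g u : G} (hu : u ∈ U) :
    extendInvolution φ s ε (g * u) = extendInvolution φ s ε g * extendZero U φ u := by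
  have h : g * u * s = g * s * (s * u * s⁻¹) := by
    rw [← eq_inv_of_mul_eq_one_left hss, ← mul_assoc, ← mul_assoc, mul_assoc g s s, hss,
      mul_one]
  rw [extendInvolution, extendInvolution, h, extendZero_mul (hU.conj_mem u hu s),
    extendZero_conj_of_fixed hfix, extendZero_mul hu]
  ring

theorem extendInvolution_mul [hU : U.Normal] (hss : s * s = 1) (hs : s ∉ U) (hε : ε * ε = 1)
    (hfix : ∀ x : U, φ ⟨s * (x : G) * s⁻¹, hU.conj_mem x.1 x.2 s⟩ = φ x) {g h : G}
    (hh : h ∈ U ∨ h * s ∈ U) :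
    extendInvolution φ s ε (g * h) = extendInvolution φ s ε g * extendInvolution φ s ε h := by
  rcases hh with hh | hh
  · rw [extendInvolution_mul_of_mem hss hfix hh, extendInvolution_of_mem hs hh]
  · have key : ∀ a : G, extendInvolution φ s ε a = ε * extendInvolution φ s ε (a * s) := fun a => by
      rw [extendInvolution_mul_involution hss hε, ← mul_assoc, hε, one_mul]
    rw [key (g * h), key h, mul_assoc g, extendInvolution_mul_of_mem hss hfix hh,
      extendInvolution_of_mem hs hh]
    ring

end ExtendZero

section Transversal

variable {G : Type*} [Group G] {U : Subgroup G} {t : G} {m : ℕ}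

theorem zpow_mem_iff_orderOf_dvd (hUt' : U ⊓ Subgroup.zpowers t = ⊥) (z : ℤ) :
    t ^ z ∈ U ↔ (orderOf t : ℤ) ∣ z := by
  rw [orderOf_dvd_iff_zpow_eq_one]
  refine ⟨fun h => ?_, fun h => h ▸ U.one_mem⟩
  have : t ^ z ∈ U ⊓ Subgroup.zpowers t := ⟨h, z, rfl⟩
  rwa [hUt', Subgroup.mem_bot] at this

theorem exists_pow_mul_mem [Finite G] [U.Normal] (hUt : U ⊔ Subgroup.zpowers t = ⊤) (b : G) :
    ∃ n < orderOf t, t ^ n * b ∈ U := by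
  have hb : b⁻¹ ∈ U ⊔ Subgroup.zpowers t := hUt ▸ Subgroup.mem_top _
  obtain ⟨u, hu, y, ⟨z, rfl⟩, huy⟩ := Subgroup.mem_sup_of_normal_left.1 hb
  have ho : (0 : ℤ) < orderOf t := by exact_mod_cast orderOf_pos t
  obtain ⟨n, hn⟩ := Int.eq_ofNat_of_zero_le (Int.emod_nonneg z ho.ne')
  have hlt := Int.emod_lt_of_pos z ho
  refine ⟨n, by omega, ?_⟩
  have h : t ^ n = t ^ z := by rw [← zpow_natCast, ← hn, zpow_mod_orderOf]
  dsimp only at huy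
  rw [h, eq_inv_mul_of_mul_eq huy, inv_mul_cancel_right]
  exact U.inv_mem hu

theorem exists_forall_pow_mul_mem_iff [Finite G] [hU : U.Normal] (ht : orderOf t = 2 * m)
    (hUt : U ⊔ Subgroup.zpowers t = ⊤) (hUt' : U ⊓ Subgroup.zpowers t = ⊥) (b : G) :
    ∃ n : Fin m, ∀ j : Fin m,
      (t ^ (j : ℕ) * b ∈ U ∨ t ^ (j : ℕ) * b * t ^ m ∈ U) ↔ j = n := by
  obtain ⟨N, hN, hNb⟩ := exists_pow_mul_mem hUt b
  have hdvd : ∀ z : ℤ, |z| < 2 * m → ((orderOf t : ℤ) ∣ z ↔ z = 0) := fun z hz => by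
    rw [ht]
    push_cast
    exact ⟨fun h => Int.eq_zero_of_abs_lt_dvd h hz, fun h => h ▸ dvd_zero _⟩
  have hmem : ∀ k : ℕ, t ^ k * b ∈ U ↔ (orderOf t : ℤ) ∣ (k : ℤ) - N := fun k => by
    have : t ^ k * b = t ^ ((k : ℤ) - N) * (t ^ N * b) := by
      rw [zpow_sub, zpow_natCast, zpow_natCast]
      group
    rw [this, U.mul_mem_cancel_right hNb, zpow_mem_iff_orderOf_dvd hUt']
  have key : ∀ j < m, (t ^ j * b ∈ U ∨ t ^ j * b * t ^ m ∈ U) ↔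
      ((j : ℤ) - N = 0 ∨ ((m + j : ℕ) : ℤ) - N = 0) := fun j hj => by
    rw [hU.mem_comm_iff (a := t ^ j * b), ← mul_assoc, ← pow_add, hmem, hmem,
      hdvd _ (by rw [abs_lt]; omega), hdvd _ (by rw [abs_lt]; omega)]
  refine ⟨⟨if N < m then N else N - m, by split_ifs <;> omega⟩, fun j => ?_⟩
  rw [key j j.2, Fin.ext_iff]
  have := j.2
  dsimp only
  split_ifs <;> omega

theorem sum_eq_card_mul_sum_range [Fintype G] [U.Normal]
    (hUt : U ⊔ Subgroup.zpowers t = ⊤) (hUt' : U ⊓ Subgroup.zpowers t = ⊥) (F : G → ℂ)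
    (hF : ∀ x, ∀ u ∈ U, F (x * u) = F x) :
    ∑ x, F x = Nat.card U * ∑ i ∈ Finset.range (orderOf t), F (t ^ i)⁻¹ := by
  have hbij : Function.Bijective
      (fun p : Fin (orderOf t) × U => (t ^ (p.1 : ℕ))⁻¹ * (p.2 : G)) := by
    refine ⟨fun p q hpq => ?_, fun x => ?_⟩
    · dsimp only at hpq
      have hz : t ^ ((q.1 : ℤ) - (p.1 : ℕ)) ∈ U := by
        have : t ^ ((q.1 : ℤ) - (p.1 : ℕ)) = q.2 * (p.2 : G)⁻¹ := by
          rw [zpow_sub, zpow_natCast, zpow_natCast, eq_mul_inv_iff_mul_eq, mul_assoc, hpq,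
            mul_inv_cancel_left]
        rw [this]
        exact U.mul_mem q.2.2 (U.inv_mem p.2.2)
      rw [zpow_mem_iff_orderOf_dvd hUt'] at hz
      have h0 := Int.eq_zero_of_abs_lt_dvd hz (by rw [abs_lt]; omega)
      have h1 : p.1 = q.1 := Fin.ext (by omega)
      rw [h1] at hpq
      exact Prod.ext h1 (Subtype.ext (mul_left_cancel hpq))
    · obtain ⟨n, hn, hu⟩ := exists_pow_mul_mem hUt x
      exact ⟨(⟨n, hn⟩, ⟨_, hu⟩), inv_mul_cancel_left _ _⟩
  classical
  rw [← Function.Bijective.sum_comp hbij F, Fintype.sum_prod_type, Finset.mul_sum,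
    ← Fin.sum_univ_eq_sum_range (fun i => (Nat.card U : ℂ) * F (t ^ i)⁻¹)]
  refine Finset.sum_congr rfl fun i _ => ?_
  simp [hF]

end Transversal

section Monomial

theorem apply_mul_inv_eq_ite {G ι : Type*} [Group G] [DecidableEq ι] {H : Set G} {χ : G → ℂ}
    {r : ι → G} (h_one : 1 ∈ H) (χ_one : χ 1 = 1) (χ_zero : ∀ g ∉ H, χ g = 0)
    (hr : ∀ b, ∃ n, ∀ j, r j * b ∈ H ↔ j = n) (i j : ι) :
    χ (r i * (r j)⁻¹) = if i = j then 1 else 0 := by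
  split_ifs with hij
  · rw [hij, mul_inv_cancel, χ_one]
  · obtain ⟨n, hn⟩ := hr (r j)⁻¹
    obtain rfl : j = n := (hn j).1 (by rwa [mul_inv_cancel])
    exact χ_zero _ fun h => hij ((hn i).1 h)

variable {G ι : Type*} [Group G] [Fintype ι] [DecidableEq ι]

/-- The representation of `G` by monomial matrices with entries `χ (rᵢ g rⱼ⁻¹)`, where `χ` vanishes
outside `H`, is multiplicative along `H`, and `r` is a right transversal of `H`. -/
noncomputable def monomialRepresentation (H : Set G) (χ : G → ℂ) (r : ι → G)
    (h_one : 1 ∈ H) (χ_one : χ 1 = 1) (χ_mul : ∀ g, ∀ h ∈ H, χ (g * h) = χ g * χ h)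
    (χ_zero : ∀ g ∉ H, χ g = 0) (hr : ∀ b, ∃ n, ∀ j, r j * b ∈ H ↔ j = n) :
    Representation ℂ G (ι → ℂ) where
  toFun g := Matrix.toLin' (Matrix.of fun i j => χ (r i * g * (r j)⁻¹))
  map_one' := by
    rw [Module.End.one_eq_id, ← Matrix.toLin'_one]
    congr 1
    ext i j
    rw [Matrix.of_apply, mul_one, Matrix.one_apply, apply_mul_inv_eq_ite h_one χ_one χ_zero hr]
  map_mul' g h := by
    rw [Module.End.mul_eq_comp, ← Matrix.toLin'_mul]
    congr 1
    ext i k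
    rw [Matrix.mul_apply]
    simp only [Matrix.of_apply]
    obtain ⟨n, hn⟩ := hr (h * (r k)⁻¹)
    rw [Finset.sum_eq_single n]
    · rw [← χ_mul _ _ (by rw [mul_assoc, hn])]
      congr 1
      group
    · intro j _ hj
      rw [χ_zero (r j * h * (r k)⁻¹) (by rwa [mul_assoc, hn]), mul_zero]
    · simp

variable {H : Set G} {χ : G → ℂ} {r : ι → G} {h_one : 1 ∈ H} {χ_one : χ 1 = 1}
  {χ_mul : ∀ g, ∀ h ∈ H, χ (g * h) = χ g * χ h} {χ_zero : ∀ g ∉ H, χ g = 0}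
  {hr : ∀ b, ∃ n, ∀ j, r j * b ∈ H ↔ j = n}

theorem trace_monomialRepresentation (g : G) :
    LinearMap.trace ℂ (ι → ℂ)
      (monomialRepresentation H χ r h_one χ_one χ_mul χ_zero hr g) =
      ∑ i, χ (r i * g * (r i)⁻¹) := by
  simp [monomialRepresentation, Matrix.trace]

theorem monomialRepresentation_apply (g : G) (w : ι → ℂ) (i : ι) :
    monomialRepresentation H χ r h_one χ_one χ_mul χ_zero hr g w i =
      ∑ j, χ (r i * g * (r j)⁻¹) * w j := rfl

theorem monomialRepresentation_single (i j : ι) :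
    monomialRepresentation H χ r h_one χ_one χ_mul χ_zero hr ((r j)⁻¹ * r i) (Pi.single i 1) =
      Pi.single j 1 := by
  ext k
  rw [monomialRepresentation_apply, Finset.sum_eq_single i]
  · rw [Pi.single_eq_same, mul_one, ← mul_assoc, mul_inv_cancel_right,
      apply_mul_inv_eq_ite h_one χ_one χ_zero hr, Pi.single_apply]
  · intro l _ hl
    rw [Pi.single_eq_of_ne hl, mul_zero]
  · simp

/-- A monomial representation whose restriction to a finite group `K` is a sum of pairwise distinct
linear characters has no proper nonzero invariant subspace. -/
theorem monomialRepresentation_eq_bot_or_eq_top {K : Type*} [Group K] [Fintype K] (f : K → G)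
    (θ : ι → K →* ℂˣ) (hθ : Function.Injective θ)
    (hdiag : ∀ k i j, χ (r i * f k * (r j)⁻¹) = if i = j then (θ j k : ℂ) else 0)
    (W : Submodule ℂ (ι → ℂ))
    (hW : ∀ g, ∀ w ∈ W, monomialRepresentation H χ r h_one χ_one χ_mul χ_zero hr g w ∈ W) :
    W = ⊥ ∨ W = ⊤ := by
  refine or_iff_not_imp_left.2 fun hbot => ?_
  obtain ⟨w, hw, hw0⟩ := W.ne_bot_iff.1 hbot
  obtain ⟨i, hi⟩ := Function.ne_iff.1 hw0
  have hp : ∑ k, ((θ i k)⁻¹ : ℂ) •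
      monomialRepresentation H χ r h_one χ_one χ_mul χ_zero hr (f k) w ∈ W :=
    W.sum_mem fun k _ => W.smul_mem _ (hW _ _ hw)
  have hpe : ∑ k, ((θ i k)⁻¹ : ℂ) •
      monomialRepresentation H χ r h_one χ_one χ_mul χ_zero hr (f k) w =
      ((Fintype.card K : ℂ) * w i) • Pi.single i 1 := by
    ext j
    rw [Finset.sum_apply, Pi.smul_apply, Pi.single_apply]
    simp only [Pi.smul_apply, monomialRepresentation_apply, hdiag, ite_mul, zero_mul,
      Finset.sum_ite_eq, Finset.mem_univ, if_true, smul_eq_mul]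
    split_ifs with hji
    · subst hji
      simp
    · have h0 := sum_hom_units_eq_zero ((Units.coeHom ℂ).comp ((θ i)⁻¹ * θ j)) fun h => hji <| by
        refine hθ (MonoidHom.ext fun k => ?_)
        have := DFunLike.congr_fun h k
        have h' : (θ i k)⁻¹ * θ j k = 1 := Units.ext this
        exact (inv_mul_eq_one.1 h').symm
      rw [mul_zero, ← zero_mul (w j), ← h0, Finset.sum_mul]
      refine Finset.sum_congr rfl fun k _ => ?_
      simp [mul_assoc]
  rw [hpe] at hp
  have hsingle : Pi.single i (1 : ℂ) ∈ W :=
    (W.smul_mem_iff (mul_ne_zero (Nat.cast_ne_zero.2 Fintype.card_ne_zero) hi)).1 hp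
  rw [eq_top_iff, ← (Pi.basisFun ℂ ι).span_eq, Submodule.span_le]
  rintro _ ⟨j, rfl⟩
  have h := hW ((r j)⁻¹ * r i) _ hsingle
  rwa [monomialRepresentation_single, ← Pi.basisFun_apply] at h

end Monomial

section TwoExtensions

variable {G : Type*} [Group G] [Fintype G] {U : Subgroup G} {t : G} {m : ℕ} {φ : U →* ℂˣ}

theorem isIrreducibleCharacter_sum_extendInvolution (hU : U.Normal) (hm : m ≠ 0)
    (ht : orderOf t = 2 * m)
    (hUt : U ⊔ Subgroup.zpowers t = ⊤)
    (hUt' : U ⊓ Subgroup.zpowers t = ⊥)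
    (hfix : ∀ x : U,
      φ ⟨t ^ m * (x : G) * (t ^ m)⁻¹, hU.conj_mem x.1 x.2 (t ^ m)⟩ = φ x)
    (hdist : ∀ i j : ℕ, i < m → j < m → i ≠ j →
      ∃ x : U, φ ⟨t ^ i * (x : G) * (t ^ i)⁻¹, hU.conj_mem x.1 x.2 (t ^ i)⟩ ≠
        φ ⟨t ^ j * (x : G) * (t ^ j)⁻¹, hU.conj_mem x.1 x.2 (t ^ j)⟩)
    (hs : t ^ m ∉ U) (hss : t ^ m * t ^ m = 1) {ε : ℂ} (hε : ε * ε = 1) :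
    IsIrreducibleCharacter G fun g =>
      ∑ i : Fin m, extendInvolution φ (t ^ m) ε (t ^ (i : ℕ) * g * (t ^ (i : ℕ))⁻¹) := by
  have h_one : (1 : G) ∈ {g : G | g ∈ U ∨ g * t ^ m ∈ U} := Or.inl U.one_mem
  have χ_one : extendInvolution φ (t ^ m) ε 1 = 1 := by
    rw [extendInvolution_of_mem hs U.one_mem, extendZero_one]
  have χ_mul : ∀ g, ∀ h ∈ {g : G | g ∈ U ∨ g * t ^ m ∈ U}, extendInvolution φ (t ^ m) ε (g * h) =
      extendInvolution φ (t ^ m) ε g * extendInvolution φ (t ^ m) ε h :=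
    fun g h hh => extendInvolution_mul hss hs hε hfix hh
  have χ_zero : ∀ g ∉ {g : G | g ∈ U ∨ g * t ^ m ∈ U}, extendInvolution φ (t ^ m) ε g = 0 :=
    fun g hg => extendInvolution_eq_zero (fun h => hg (Or.inl h)) fun h => hg (Or.inr h)
  have hr := exists_forall_pow_mul_mem_iff (U := U) ht hUt hUt'
  let θ : Fin m → U →* ℂˣ := fun i => φ.comp (MulAut.conjNormal (t ^ (i : ℕ))).toMonoidHom
  refine ⟨m, monomialRepresentation _ _ (fun i : Fin m => t ^ (i : ℕ)) h_one χ_one χ_mul χ_zero hr,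
    fun g => (trace_monomialRepresentation g).symm, hm, ?_⟩
  have := Fintype.ofFinite U
  refine monomialRepresentation_eq_bot_or_eq_top (fun u : U => (u : G)) θ ?_ ?_
  · intro i j hij
    by_contra hne
    obtain ⟨x, hx⟩ := hdist i j i.2 j.2 (Fin.val_ne_of_ne hne)
    exact hx (DFunLike.congr_fun hij x)
  · intro u i j
    have hu : t ^ (j : ℕ) * (u : G) * (t ^ (j : ℕ))⁻¹ ∈ U := hU.conj_mem u u.2 _
    have h : t ^ (i : ℕ) * (u : G) * (t ^ (j : ℕ))⁻¹ =
        t ^ (i : ℕ) * (t ^ (j : ℕ))⁻¹ * (t ^ (j : ℕ) * (u : G) * (t ^ (j : ℕ))⁻¹) := by group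
    rw [h, extendInvolution_mul_of_mem hss hfix hu,
      apply_mul_inv_eq_ite (r := fun i : Fin m => t ^ (i : ℕ)) h_one χ_one χ_zero hr,
      extendZero_of_mem hu, ite_mul, one_mul, zero_mul]
    rfl

theorem inducedChar_eq_two_mul_sum (hU : U.Normal) (ht : orderOf t = 2 * m)
    (hUt : U ⊔ Subgroup.zpowers t = ⊤)
    (hUt' : U ⊓ Subgroup.zpowers t = ⊥)
    (hfix : ∀ x : U,
      φ ⟨t ^ m * (x : G) * (t ^ m)⁻¹, hU.conj_mem x.1 x.2 (t ^ m)⟩ = φ x) (g : G) :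
    inducedChar U (fun x => (φ x : ℂ)) g =
      2 * ∑ i : Fin m, extendZero U φ (t ^ (i : ℕ) * g * (t ^ (i : ℕ))⁻¹) := by
  rw [inducedChar_eq_sum_extendZero, sum_eq_card_mul_sum_range hUt hUt'
    (fun x => extendZero U φ (x⁻¹ * g * x)), inv_mul_cancel_left₀ (Nat.cast_ne_zero.2 Nat.card_pos.ne'), ht, two_mul m,
    Finset.sum_range_add,
    Fin.sum_univ_eq_sum_range (fun i => extendZero U φ (t ^ i * g * (t ^ i)⁻¹)), two_mul]
  · congr 1
    · simp only [inv_inv]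
    · refine Finset.sum_congr rfl fun i _ => ?_
      rw [← extendZero_conj_of_fixed hfix (t ^ i * g * (t ^ i)⁻¹), pow_add]
      congr 1
      group
  · intro x u hu
    rw [← extendZero_conj_of_mem hu (g := x⁻¹ * g * x)]
    congr 1
    group

end TwoExtensions

/-- Let `G` be a finite group with a normal subgroup `U` and an element `t` of
order `2m` such that `G = U⟨t⟩` and `U ∩ ⟨t⟩ = 1`.  Let `φ` be a linear
character of `U` fixed by conjugation by `t^m`, whose `m` conjugates
`x ↦ φ(tⁱ x t⁻ⁱ)`, `0 ≤ i < m`, are pairwise distinct.  Then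
`Ind_U^G(φ) = ψ₁ + ψ₂` for two distinct irreducible characters `ψ₁, ψ₂` of `G`,
each of degree `m`. -/
theorem induced_linear_character_sum_of_two_irreducibles
    {G : Type*} [Group G] [Fintype G]
    (U : Subgroup G) (hU : U.Normal) (t : G) (m : ℕ)
    (ht : orderOf t = 2 * m)
    (hUt : U ⊔ Subgroup.zpowers t = ⊤)
    (hUt' : U ⊓ Subgroup.zpowers t = ⊥)
    (φ : U →* ℂˣ)
    (hfix : ∀ x : U,
      φ ⟨t ^ m * (x : G) * (t ^ m)⁻¹, hU.conj_mem x.1 x.2 (t ^ m)⟩ = φ x)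
    (hdist : ∀ i j : ℕ, i < m → j < m → i ≠ j →
      ∃ x : U, φ ⟨t ^ i * (x : G) * (t ^ i)⁻¹, hU.conj_mem x.1 x.2 (t ^ i)⟩ ≠
        φ ⟨t ^ j * (x : G) * (t ^ j)⁻¹, hU.conj_mem x.1 x.2 (t ^ j)⟩) :
    ∃ ψ₁ ψ₂ : G → ℂ,
      IsIrreducibleCharacter G ψ₁ ∧ IsIrreducibleCharacter G ψ₂ ∧ ψ₁ ≠ ψ₂ ∧
      ψ₁ 1 = (m : ℂ) ∧ ψ₂ 1 = (m : ℂ) ∧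
      ∀ g : G, inducedChar U (fun x => (φ x : ℂ)) g = ψ₁ g + ψ₂ g := by
  have hm : m ≠ 0 := by
    rintro rfl
    exact (orderOf_pos t).ne' ht
  have hss : t ^ m * t ^ m = 1 := by
    rw [← pow_add, ← two_mul, ← ht, pow_orderOf_eq_one]
  have hs : t ^ m ∉ U := by
    rw [← zpow_natCast, zpow_mem_iff_orderOf_dvd hUt', Int.natCast_dvd_natCast, ht]
    exact fun h => absurd (Nat.le_of_dvd (Nat.pos_of_ne_zero hm) h) (by omega)
  have hval : ∀ ε : ℂ, ∑ i : Fin m, extendInvolution φ (t ^ m) ε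
      (t ^ (i : ℕ) * 1 * (t ^ (i : ℕ))⁻¹) = m := fun ε => by
    simp [extendInvolution_of_mem hs U.one_mem, extendZero_one]
  have hval' : ∀ ε : ℂ, ε * ε = 1 → ∑ i : Fin m, extendInvolution φ (t ^ m) ε
      (t ^ (i : ℕ) * t ^ m * (t ^ (i : ℕ))⁻¹) = m * ε := fun ε hε => by
    have h1 : extendInvolution φ (t ^ m) ε (t ^ m) = ε := by
      have := extendInvolution_mul_involution (φ := φ) hss hε 1
      rwa [one_mul, extendInvolution_of_mem hs U.one_mem, extendZero_one, mul_one] at this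
    have h2 : ∀ i : ℕ, t ^ i * t ^ m * (t ^ i)⁻¹ = t ^ m := fun i => by
      rw [← pow_add, add_comm, pow_add, mul_inv_cancel_right]
    simp [h2, h1]
  refine ⟨_, _,
    isIrreducibleCharacter_sum_extendInvolution hU hm ht hUt hUt' hfix hdist hs hss
      (one_mul 1),
    isIrreducibleCharacter_sum_extendInvolution hU hm ht hUt hUt' hfix hdist hs hss
      (ε := -1) (by norm_num), fun h => ?_, hval 1, hval (-1), fun g => ?_⟩
  · have := congrFun h (t ^ m)
    rw [hval' 1 (one_mul 1), hval' (-1) (by norm_num)] at this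
    have hm' : (m : ℂ) ≠ 0 := Nat.cast_ne_zero.2 hm
    have := mul_left_cancel₀ hm' this
    norm_num at this
  · rw [inducedChar_eq_two_mul_sum hU ht hUt hUt' hfix, ← Finset.sum_add_distrib, Finset.mul_sum]
    refine Finset.sum_congr rfl fun i _ => ?_
    simp only [extendInvolution]
    ring
end
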